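/- arXiv:2508.11135 — 3 statements merged into one kernel-verified Lean document; each statement's English description precedes it below -/
import Mathlib

section
/- For every isosceles right triangle T* in ℝ², the first mixed eigenvalue with Dirichlet condition on the two legs and Neumann condition on the hypotenuse equals π²/|T*|, i.e. λ₁^{MS}(T*) = π²/|T*|. -/
open MeasureTheory Set EuclideanGeometry

noncomputable section

abbrev E2 : Type := EuclideanSpace ℝ (Fin 2)

/-- The Rayleigh quotient of a function `u` on the domain `Ω ⊆ ℝ²`. -/
def rayleigh (Ω : Set E2) (u : E2 → ℝ) : ℝ :=
  (∫ x in Ω, ‖fderiv ℝ u x‖ ^ 2) / (∫ x in Ω, (u x) ^ 2)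

/-- `u` is not almost everywhere zero on `Ω`. -/
def NotAEZero (Ω : Set E2) (u : E2 → ℝ) : Prop :=
  ¬ (∀ᵐ x ∂(volume.restrict Ω), u x = 0)

/-- The first mixed Dirichlet–Neumann eigenvalue of the Laplacian on `Ω`,
with Dirichlet condition on `D` and Neumann condition on the rest of the boundary,
defined variationally. -/
def firstMixedEig (Ω D : Set E2) : ℝ :=
  sInf { r | ∃ u : E2 → ℝ, ContDiff ℝ (⊤ : ℕ∞) u ∧ (∀ x ∈ D, u x = 0) ∧
    NotAEZero Ω u ∧ r = rayleigh Ω u }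

/-- The `k`-th mixed Dirichlet–Neumann eigenvalue of the Laplacian on `Ω`,
with Dirichlet condition on `D`, via the Courant–Fischer min–max principle. -/
def mixedEig (Ω D : Set E2) (k : ℕ) : ℝ :=
  sInf { r | ∃ V : Submodule ℝ (E2 → ℝ), Module.finrank ℝ V = k ∧
    (∀ u ∈ V, ContDiff ℝ (⊤ : ℕ∞) u ∧ ∀ x ∈ D, u x = 0) ∧
    r = sSup { q | ∃ u ∈ V, NotAEZero Ω u ∧ q = rayleigh Ω u } }

/-- The open triangle with vertices `A`, `B`, `C`. -/
def triangleO (A B C : E2) : Set E2 := interior (convexHull ℝ ({A, B, C} : Set E2))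

/-- The area of a plane region. -/
def area2 (s : Set E2) : ℝ := (volume s).toReal

/-- The open rectangle `(0,a) × (0,b)`. -/
def rectO (a b : ℝ) : Set E2 := {p : E2 | p 0 ∈ Ioo 0 a ∧ p 1 ∈ Ioo 0 b}

/-- The closed rectangle `[0,a] × [0,b]`. -/
def rectC (a b : ℝ) : Set E2 := {p : E2 | p 0 ∈ Icc 0 a ∧ p 1 ∈ Icc 0 b}

/-- The two vertical sides of the closed rectangle `[0,a] × [0,b]`. -/
def vSides (a b : ℝ) : Set E2 := {p : E2 | (p 0 = 0 ∨ p 0 = a) ∧ p 1 ∈ Icc 0 b}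

/-- The two horizontal sides of the closed rectangle `[0,a] × [0,b]`. -/
def hSides (a b : ℝ) : Set E2 := {p : E2 | p 0 ∈ Icc 0 a ∧ (p 1 = 0 ∨ p 1 = b)}

/-- `F(y) = Σ_{j=0}^∞ ((y − j²)₊)^{1/2}`. -/
def Ffun (y : ℝ) : ℝ := ∑' j : ℕ, Real.sqrt (max (y - (j : ℝ) ^ 2) 0)

/-- `M`, the inverse function of `F` on `[0,∞)`. -/
def Mfun (x : ℝ) : ℝ := sInf {y : ℝ | 0 ≤ y ∧ x ≤ Ffun y}

/-- The closed right triangle `{x ≥ 0, y ≥ 0, x + y ≤ a}`. -/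
def stdTriangle (a : ℝ) : Set (ℝ × ℝ) := {p | 0 ≤ p.1 ∧ 0 ≤ p.2 ∧ p.1 + p.2 ≤ a}

lemma isClosed_stdTriangle (a : ℝ) : IsClosed (stdTriangle a) :=
  (isClosed_le continuous_const continuous_fst).inter
    ((isClosed_le continuous_const continuous_snd).inter
      (isClosed_le (continuous_fst.add continuous_snd) continuous_const))

lemma isCompact_stdTriangle (a : ℝ) : IsCompact (stdTriangle a) := by
  refine (isCompact_Icc (a := ((0 : ℝ), (0 : ℝ))) (b := (a, a))).of_isClosed_subset
    (isClosed_stdTriangle a) ?_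
  rintro ⟨x, y⟩ ⟨hx, hy, hxy⟩
  simp only at hx hy hxy
  exact ⟨⟨hx, hy⟩, ⟨by simp only; linarith, by simp only; linarith⟩⟩

lemma setIntegral_stdTriangle {a : ℝ} (ha : 0 ≤ a) {h : ℝ × ℝ → ℝ} (hc : Continuous h) :
    ∫ p in stdTriangle a, h p = ∫ x in 0..a, ∫ y in 0..(a - x), h (x, y) := by
  have hm := (isClosed_stdTriangle a).measurableSet
  have hi : IntegrableOn h (stdTriangle a) :=
    hc.continuousOn.integrableOn_compact (isCompact_stdTriangle a)
  rw [← integral_indicator hm, Measure.volume_eq_prod,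
    integral_prod _ ((integrable_indicator_iff hm).2 hi), intervalIntegral.integral_of_le ha,
    ← integral_Icc_eq_integral_Ioc, ← integral_indicator measurableSet_Icc]
  congr 1
  ext x
  by_cases hx : x ∈ Icc 0 a
  · rw [indicator_of_mem hx, intervalIntegral.integral_of_le (by linarith [hx.2]),
      ← integral_Icc_eq_integral_Ioc, ← integral_indicator measurableSet_Icc]
    congr 1
    ext y
    have : (x, y) ∈ stdTriangle a ↔ y ∈ Icc 0 (a - x) :=
      ⟨fun h => ⟨h.2.1, by linarith [h.2.2]⟩, fun h => ⟨hx.1, h.1, by simp only; linarith [h.2]⟩⟩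
    by_cases hy : y ∈ Icc 0 (a - x)
    · rw [indicator_of_mem hy, indicator_of_mem (this.2 hy)]
    · rw [indicator_of_notMem hy, indicator_of_notMem (mt this.1 hy)]
  · rw [indicator_of_notMem hx]
    refine integral_eq_zero_of_ae (.of_forall fun y => ?_)
    refine indicator_of_notMem (fun h => hx ⟨h.1, ?_⟩) _
    have h1 := h.2.1
    have h2 := h.2.2
    simp only at h1 h2
    linarith

lemma setIntegral_stdTriangle_swap (a : ℝ) (h : ℝ × ℝ → ℝ) :
    ∫ p in stdTriangle a, h p.swap = ∫ p in stdTriangle a, h p := by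
  have : Prod.swap ⁻¹' stdTriangle a = stdTriangle a := by
    ext p
    simp only [stdTriangle, mem_preimage, mem_ofPred_eq, Prod.fst_swap, Prod.snd_swap]
    rw [add_comm]
    tauto
  conv_lhs => rw [← this]
  exact (Measure.measurePreserving_swap (μ := (volume : Measure ℝ))
    (ν := (volume : Measure ℝ))).setIntegral_preimage_emb
      MeasurableEquiv.prodComm.measurableEmbedding h _

lemma continuous_integral_slice (a : ℝ) {h : ℝ × ℝ → ℝ} (hc : Continuous h) :
    Continuous fun x => ∫ y in 0..(a - x), h (x, y) :=
  intervalIntegral.continuous_parametric_intervalIntegral_of_continuous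
    (f := fun x y => h (x, y)) (by simpa [Function.uncurry_def] using hc) (by fun_prop)

/-- The sum of two integrals over a right triangle, sliced in the two directions of the legs and
paired along the hypotenuse. -/
lemma setIntegral_stdTriangle_add {a : ℝ} (ha : 0 ≤ a) {g h : ℝ × ℝ → ℝ} (hg : Continuous g)
    (hh : Continuous h) :
    ∫ p in stdTriangle a, (g p + h p) =
      ∫ t in 0..a, ((∫ x in 0..(a - t), g (x, t)) + ∫ y in 0..t, h (a - t, y)) := by
  have hi {f : ℝ × ℝ → ℝ} (hf : Continuous f) : IntegrableOn f (stdTriangle a) :=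
    hf.continuousOn.integrableOn_compact (isCompact_stdTriangle a)
  have hgs := continuous_integral_slice a (h := fun p => g p.swap) (hg.comp continuous_swap)
  have hhs := continuous_integral_slice a hh
  rw [integral_add (hi hg) (hi hh), ← setIntegral_stdTriangle_swap a g,
    setIntegral_stdTriangle ha (h := fun p => g p.swap) (hg.comp continuous_swap),
    setIntegral_stdTriangle ha hh]
  have hhs' : Continuous fun x => ∫ y in 0..(a - (a - x)), h (a - x, y) :=
    hhs.comp (continuous_sub_left a)
  have hrev := intervalIntegral.integral_comp_sub_left (a := 0) (b := a)
    (fun x => ∫ y in 0..(a - x), h (x, y)) a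
  rw [sub_self, sub_zero] at hrev
  rw [← hrev, ← intervalIntegral.integral_add (hgs.intervalIntegrable _ _)
    (hhs'.intervalIntegrable _ _)]
  simp

/-- A one-dimensional Hardy-type inequality, sharp for `sin (k x)`. -/
lemma cot_mul_sq_le_integral {k l : ℝ} (hk : 0 < k) (hl : 0 < l) (hkl : k * l < Real.pi)
    {f f' : ℝ → ℝ} (hf : ∀ x, HasDerivAt f (f' x) x) (hf' : Continuous f') (h0 : f 0 = 0) :
    k * (Real.cos (k * l) / Real.sin (k * l)) * f l ^ 2 ≤
      ∫ x in 0..l, (f' x ^ 2 - k ^ 2 * f x ^ 2) := by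
  have hfc : Continuous f := continuous_iff_continuousAt.2 fun x => (hf x).continuousAt
  have hsin {x : ℝ} (hx : x ∈ Ioc 0 l) : 0 < Real.sin (k * x) :=
    Real.sin_pos_of_pos_of_lt_pi (mul_pos hk hx.1)
      ((mul_le_mul_of_nonneg_left hx.2 hk.le).trans_lt hkl)
  set g : ℝ → ℝ := fun x => f x * dslope f 0 x * (Real.cos (k * x) / Real.sinc (k * x)) with hg
  have hgeq {x : ℝ} (hx : x ≠ 0) :
      g x = f x ^ 2 * (k * (Real.cos (k * x) / Real.sin (k * x))) := by
    simp only [hg]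
    rw [dslope_of_ne _ hx, slope_def_field, Real.sinc_of_ne_zero (mul_ne_zero hk.ne' hx), h0]
    by_cases hs : Real.sin (k * x) = 0
    · simp [hs]
    field_simp
    ring
  have hgc : ContinuousOn g (Icc 0 l) := by
    have hd : Continuous (dslope f 0) := by
      rw [← continuousOn_univ, continuousOn_dslope Filter.univ_mem]
      exact ⟨hfc.continuousOn, (hf 0).differentiableAt⟩
    refine (hfc.mul hd).continuousOn.mul (ContinuousOn.div (by fun_prop)
      (Real.continuous_sinc.comp (continuous_const_mul k)).continuousOn fun x hx => ?_)
    rcases hx.1.eq_or_lt with rfl | hx0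
    · simp
    · rw [Real.sinc_of_ne_zero (mul_pos hk hx0).ne']
      exact (div_pos (hsin ⟨hx0, hx.2⟩) (mul_pos hk hx0)).ne'
  have key := intervalIntegral.sub_le_integral_of_hasDeriv_right_of_le (g := g)
    (φ := fun x => f' x ^ 2 - k ^ 2 * f x ^ 2)
    (g' := fun x => 2 * f x * f' x * (k * (Real.cos (k * x) / Real.sin (k * x))) +
      f x ^ 2 * (k * (-(k / Real.sin (k * x) ^ 2)))) hl.le hgc ?_ ?_ ?_
  · rw [hgeq hl.ne'] at key
    simp only [hg, h0] at key
    linarith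
  · intro x hx
    have hs := hsin ⟨hx.1, hx.2.le⟩
    have hkx : HasDerivAt (fun x => k * x) k x := by simpa using (hasDerivAt_id x).const_mul k
    have h1 := ((hf x).pow 2).mul
      ((hkx.cos.div hkx.sin hs.ne').const_mul k)
    refine HasDerivAt.hasDerivWithinAt ((h1.congr_of_eventuallyEq ?_).congr_deriv ?_)
    · filter_upwards [lt_mem_nhds hx.1] with z hz
      exact hgeq hz.ne'
    · have hsc := Real.sin_sq_add_cos_sq (k * x)
      simp only [Pi.pow_apply, Pi.div_apply]
      have : -Real.sin (k * x) * k * Real.sin (k * x) - Real.cos (k * x) * (Real.cos (k * x) * k)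
          = - k := by linear_combination (-k) * hsc
      rw [this]
      push_cast
      ring
  · exact (by fun_prop : Continuous fun x => f' x ^ 2 - k ^ 2 * f x ^ 2).integrableOn_Icc
  · intro x hx
    have hs := hsin ⟨hx.1, hx.2.le⟩
    have hsc := Real.sin_sq_add_cos_sq (k * x)
    have : f' x ^ 2 - k ^ 2 * f x ^ 2 - (2 * f x * f' x *
        (k * (Real.cos (k * x) / Real.sin (k * x))) +
        f x ^ 2 * (k * (-(k / Real.sin (k * x) ^ 2)))) =
        (f' x - f x * (k * (Real.cos (k * x) / Real.sin (k * x)))) ^ 2 := by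
      field_simp
      linear_combination (- k ^ 2 * f x ^ 2) * hsc
    linarith [sq_nonneg (f' x - f x * (k * (Real.cos (k * x) / Real.sin (k * x))))]

/-- The mixed Poincaré inequality on a standard right triangle, for functions vanishing on the
legs. -/
lemma mixed_poincare_stdTriangle {a : ℝ} (ha : 0 < a) {v vx vy : ℝ × ℝ → ℝ}
    (hvx : Continuous vx) (hvy : Continuous vy) (hv : Continuous v)
    (hdx : ∀ x y, HasDerivAt (fun x => v (x, y)) (vx (x, y)) x)
    (hdy : ∀ x y, HasDerivAt (fun y => v (x, y)) (vy (x, y)) y)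
    (h0x : ∀ y ∈ Icc 0 a, v (0, y) = 0) (h0y : ∀ x ∈ Icc 0 a, v (x, 0) = 0) :
    2 * (Real.pi / a) ^ 2 * ∫ p in stdTriangle a, v p ^ 2 ≤
      ∫ p in stdTriangle a, (vx p ^ 2 + vy p ^ 2) := by
  set k := Real.pi / a with hk
  have hk0 : 0 < k := div_pos Real.pi_pos ha
  have hka : k * a = Real.pi := div_mul_cancel₀ _ ha.ne'
  have hi {f : ℝ × ℝ → ℝ} (hf : Continuous f) : IntegrableOn f (stdTriangle a) :=
    hf.continuousOn.integrableOn_compact (isCompact_stdTriangle a)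
  rw [← integral_const_mul, ← sub_nonneg,
    ← integral_sub (hi (by fun_prop)) (hi (by fun_prop))]
  have := setIntegral_stdTriangle_add ha.le (g := fun p => vx p ^ 2 - k ^ 2 * v p ^ 2)
    (h := fun p => vy p ^ 2 - k ^ 2 * v p ^ 2) (by fun_prop) (by fun_prop)
  calc (0 : ℝ) ≤ _ := ?_
    _ = _ := this.symm
    _ = _ := by congr 1; ext p; ring
  rw [intervalIntegral.integral_of_le ha.le, integral_Ioc_eq_integral_Ioo]
  refine setIntegral_nonneg measurableSet_Ioo fun t ht => ?_
  have hx := cot_mul_sq_le_integral hk0 (sub_pos.2 ht.2)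
    (hka ▸ mul_lt_mul_of_pos_left (sub_lt_self a ht.1) hk0) (fun x => hdx x t)
    (by fun_prop) (h0x t ⟨ht.1.le, ht.2.le⟩)
  have hy := cot_mul_sq_le_integral hk0 ht.1
    (hka ▸ mul_lt_mul_of_pos_left ht.2 hk0) (fun y => hdy (a - t) y)
    (by fun_prop) (h0y (a - t) ⟨by linarith [ht.2], by linarith [ht.1]⟩)
  rw [mul_sub, hka, Real.cos_pi_sub, Real.sin_pi_sub, neg_div] at hx
  linarith

lemma integral_deriv_sq_sub_sin_sq (k s l : ℝ) :
    ∫ x in 0..l, ((k * Real.cos (k * x) * s) ^ 2 - k ^ 2 * (Real.sin (k * x) * s) ^ 2) =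
      k * s ^ 2 * (Real.sin (k * l) * Real.cos (k * l)) := by
  have hd (x : ℝ) : HasDerivAt (fun x => k * s ^ 2 * (Real.sin (k * x) * Real.cos (k * x)))
      ((k * Real.cos (k * x) * s) ^ 2 - k ^ 2 * (Real.sin (k * x) * s) ^ 2) x := by
    have hkx : HasDerivAt (fun x => k * x) k x := by simpa using (hasDerivAt_id x).const_mul k
    refine ((hkx.sin.mul hkx.cos).const_mul (k * s ^ 2)).congr_deriv ?_
    ring
  rw [intervalIntegral.integral_eq_sub_of_hasDerivAt (fun x _ => hd x)
    ((by fun_prop : Continuous _).intervalIntegrable _ _)]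
  simp

/-- Equality in the mixed Poincaré inequality holds for a product of sines. -/
lemma setIntegral_stdTriangle_sin_mul_sin {a : ℝ} (ha : 0 < a) {k : ℝ} (hk : k = Real.pi / a) :
    ∫ p in stdTriangle a, ((k * Real.cos (k * p.1) * Real.sin (k * p.2)) ^ 2 +
        (k * Real.cos (k * p.2) * Real.sin (k * p.1)) ^ 2) =
      2 * k ^ 2 * ∫ p in stdTriangle a, (Real.sin (k * p.1) * Real.sin (k * p.2)) ^ 2 := by
  have hka : k * a = Real.pi := hk ▸ div_mul_cancel₀ _ ha.ne'
  have hi {f : ℝ × ℝ → ℝ} (hf : Continuous f) : IntegrableOn f (stdTriangle a) :=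
    hf.continuousOn.integrableOn_compact (isCompact_stdTriangle a)
  rw [← integral_const_mul, ← sub_eq_zero,
    ← integral_sub (hi (by fun_prop)) (hi (by fun_prop))]
  have := setIntegral_stdTriangle_add ha.le
    (g := fun p => (k * Real.cos (k * p.1) * Real.sin (k * p.2)) ^ 2 -
      k ^ 2 * (Real.sin (k * p.1) * Real.sin (k * p.2)) ^ 2)
    (h := fun p => (k * Real.cos (k * p.2) * Real.sin (k * p.1)) ^ 2 -
      k ^ 2 * (Real.sin (k * p.2) * Real.sin (k * p.1)) ^ 2) (by fun_prop) (by fun_prop)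
  calc _ = _ := by congr 1; ext p; ring
    _ = _ := this
    _ = 0 := ?_
  simp only [integral_deriv_sq_sub_sin_sq, mul_sub, hka, Real.cos_pi_sub, Real.sin_pi_sub]
  refine (intervalIntegral.integral_congr (g := fun _ => (0 : ℝ)) fun t _ => ?_).trans (by simp)
  simp only
  ring

lemma volume_real_stdTriangle {a : ℝ} (ha : 0 ≤ a) :
    volume.real (stdTriangle a) = a ^ 2 / 2 := by
  have := setIntegral_stdTriangle ha (h := fun _ => 1) continuous_const
  simp only [setIntegral_const, smul_eq_mul, mul_one, intervalIntegral.integral_const,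
    sub_zero] at this
  rw [this, intervalIntegral.integral_sub (by simp) (by simp)]
  simp
  ring

/-- Cartesian coordinates on the plane with origin `A` and axes given by an orthonormal basis. -/
def cartesianChart (A : E2) (b : OrthonormalBasis (Fin 2) ℝ E2) : ℝ × ℝ ≃ᵐ E2 :=
  (MeasurableEquiv.finTwoArrow.symm.trans (MeasurableEquiv.toLp 2 (Fin 2 → ℝ))).trans
    (b.repr.symm.toMeasurableEquiv.trans (MeasurableEquiv.addLeft A))

lemma cartesianChart_apply (A : E2) (b : OrthonormalBasis (Fin 2) ℝ E2) (p : ℝ × ℝ) :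
    cartesianChart A b p = A + (p.1 • b 0 + p.2 • b 1) := by
  have : cartesianChart A b p = A + b.repr.symm (WithLp.toLp 2 ![p.1, p.2]) := rfl
  rw [this, ← b.sum_repr_symm]
  simp

lemma measurePreserving_cartesianChart (A : E2) (b : OrthonormalBasis (Fin 2) ℝ E2) :
    MeasurePreserving (cartesianChart A b) :=
  ((volume_preserving_finTwoArrow ℝ).symm.trans
    (PiLp.volume_preserving_toLp (Fin 2))).trans
      (b.measurePreserving_repr_symm.trans (measurePreserving_add_left volume A))

lemma continuous_cartesianChart (A : E2) (b : OrthonormalBasis (Fin 2) ℝ E2) :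
    Continuous (cartesianChart A b) := by
  have : (cartesianChart A b : ℝ × ℝ → E2) = fun p => A + (p.1 • b 0 + p.2 • b 1) :=
    funext (cartesianChart_apply A b)
  rw [this]
  fun_prop

lemma cartesianChart_mem_convexHull (A : E2) (b : OrthonormalBasis (Fin 2) ℝ E2) {a : ℝ}
    (ha : 0 < a) (p : ℝ × ℝ) :
    cartesianChart A b p ∈ convexHull ℝ {A, A + a • b 0, A + a • b 1} ↔ p ∈ stdTriangle a := by
  have hb := b.inner_eq_ite
  rw [cartesianChart_apply]
  constructor
  · intro h
    have hsub : convexHull ℝ {A, A + a • b 0, A + a • b 1} ⊆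
        {q : E2 | 0 ≤ inner ℝ (b 0) (q - A)} ∩ ({q : E2 | 0 ≤ inner ℝ (b 1) (q - A)} ∩
          {q : E2 | inner ℝ (b 0 + b 1) (q - A) ≤ a}) := by
      refine convexHull_min ?_ ?_
      · rintro q (rfl | rfl | rfl) <;>
          simp [inner_smul_right, inner_add_left, hb, ha.le]
      · have hl (w : E2) : IsLinearMap ℝ fun q : E2 => inner ℝ w q :=
          ⟨fun _ _ => inner_add_right _ _ _, fun _ _ => inner_smul_right _ _ _⟩
        simp only [inner_sub_right, sub_nonneg, sub_le_iff_le_add]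
        exact (convex_halfSpace_ge (hl _) _).inter
          ((convex_halfSpace_ge (hl _) _).inter (convex_halfSpace_le (hl _) _))
    have := hsub h
    simpa [inner_smul_right, inner_add_left, inner_add_right, hb, stdTriangle] using this
  · rintro ⟨h1, h2, h3⟩
    have hA : A ∈ convexHull ℝ {A, A + a • b 0, A + a • b 1} := subset_convexHull _ _ (by simp)
    have hB : A + a • b 0 ∈ convexHull ℝ {A, A + a • b 0, A + a • b 1} :=
      subset_convexHull _ _ (by simp)
    have hC : A + a • b 1 ∈ convexHull ℝ {A, A + a • b 0, A + a • b 1} :=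
      subset_convexHull _ _ (by simp)
    have := (convex_convexHull ℝ {A, A + a • b 0, A + a • b 1}).sum_mem
      (t := Finset.univ) (w := ![1 - (p.1 + p.2) / a, p.1 / a, p.2 / a])
      (z := ![A, A + a • b 0, A + a • b 1]) ?_ ?_ ?_
    · convert this using 1
      simp only [Fin.sum_univ_three, Matrix.cons_val]
      have e1 : p.1 = p.1 / a * a := by field_simp
      have e2 : p.2 = p.2 / a * a := by field_simp
      rw [smul_add, smul_add, smul_smul, smul_smul, ← e1, ← e2, add_div]
      module
    · have : (p.1 + p.2) / a ≤ 1 := (div_le_one ha).2 h3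
      intro i _
      fin_cases i
      · simpa using this
      · exact div_nonneg h1 ha.le
      · exact div_nonneg h2 ha.le
    · simp only [Fin.sum_univ_three, Matrix.cons_val]
      ring
    · intro i _
      fin_cases i <;> assumption

/-- Integrals over the open triangle, in Cartesian coordinates along the legs. -/
lemma setIntegral_triangleO (A : E2) (b : OrthonormalBasis (Fin 2) ℝ E2) {a : ℝ}
    (ha : 0 < a) (f : E2 → ℝ) :
    ∫ x in triangleO A (A + a • b 0) (A + a • b 1), f x =
      ∫ p in stdTriangle a, f (cartesianChart A b p) := by
  have hae : triangleO A (A + a • b 0) (A + a • b 1) =ᵐ[volume]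
      convexHull ℝ {A, A + a • b 0, A + a • b 1} :=
    interior_ae_eq_of_null_frontier ((convex_convexHull ℝ _).addHaar_frontier volume)
  have hpre : cartesianChart A b ⁻¹' convexHull ℝ {A, A + a • b 0, A + a • b 1} = stdTriangle a :=
    Set.ext (cartesianChart_mem_convexHull A b ha)
  rw [setIntegral_congr_set hae, ← hpre]
  exact ((measurePreserving_cartesianChart A b).setIntegral_preimage_emb
    (cartesianChart A b).measurableEmbedding f _).symm

lemma area2_convexHull (A : E2) (b : OrthonormalBasis (Fin 2) ℝ E2) {a : ℝ} (ha : 0 < a) :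
    area2 (convexHull ℝ {A, A + a • b 0, A + a • b 1}) = volume.real (stdTriangle a) := by
  have hpre : cartesianChart A b ⁻¹' convexHull ℝ {A, A + a • b 0, A + a • b 1} = stdTriangle a :=
    Set.ext (cartesianChart_mem_convexHull A b ha)
  rw [area2, ← hpre, ← (measurePreserving_cartesianChart A b).measure_preimage_equiv]
  rfl

lemma hasDerivAt_comp_cartesianChart_fst (A : E2) (b : OrthonormalBasis (Fin 2) ℝ E2) {u : E2 → ℝ}
    (hu : Differentiable ℝ u) (x y : ℝ) :
    HasDerivAt (fun x => u (cartesianChart A b (x, y)))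
      (fderiv ℝ u (cartesianChart A b (x, y)) (b 0)) x := by
  have h : HasDerivAt (fun x => cartesianChart A b (x, y)) (b 0) x := by
    simp only [cartesianChart_apply]
    simpa using (((hasDerivAt_id x).smul_const (b 0)).add_const (y • b 1)).const_add A
  exact (hu _).hasFDerivAt.comp_hasDerivAt x h

lemma hasDerivAt_comp_cartesianChart_snd (A : E2) (b : OrthonormalBasis (Fin 2) ℝ E2) {u : E2 → ℝ}
    (hu : Differentiable ℝ u) (x y : ℝ) :
    HasDerivAt (fun y => u (cartesianChart A b (x, y)))
      (fderiv ℝ u (cartesianChart A b (x, y)) (b 1)) y := by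
  have h : HasDerivAt (fun y => cartesianChart A b (x, y)) (b 1) y := by
    simp only [cartesianChart_apply]
    simpa using (((hasDerivAt_id y).smul_const (b 1)).const_add (x • b 0)).const_add A
  exact (hu _).hasFDerivAt.comp_hasDerivAt y h

lemma add_smul_mem_segment {A e : E2} {a t : ℝ} (ha : 0 < a) (ht : t ∈ Icc 0 a) :
    A + t • e ∈ segment ℝ A (A + a • e) := by
  rw [segment_eq_image']
  refine ⟨t / a, ⟨div_nonneg ht.1 ha.le, (div_le_one ha).2 ht.2⟩, ?_⟩
  simp [smul_smul, div_mul_cancel₀ _ ha.ne']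

lemma exists_eq_add_smul_of_mem_segment {A e x : E2} {a : ℝ} (hx : x ∈ segment ℝ A (A + a • e)) :
    ∃ t : ℝ, x = A + t • e := by
  rw [segment_eq_image'] at hx
  obtain ⟨t, -, rfl⟩ := hx
  exact ⟨t * a, by simp [smul_smul]⟩

lemma NotAEZero.setIntegral_sq_pos {Ω : Set E2} {u : E2 → ℝ} (h : NotAEZero Ω u)
    (hΩ : Bornology.IsBounded Ω) (hu : Continuous u) : 0 < ∫ x in Ω, u x ^ 2 := by
  refine (integral_nonneg fun x => sq_nonneg (u x)).lt_of_ne' fun h0 => h ?_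
  have hi : IntegrableOn (fun x => u x ^ 2) Ω :=
    ((hu.pow 2).continuousOn.integrableOn_compact hΩ.isCompact_closure).mono_set subset_closure
  filter_upwards [(integral_eq_zero_iff_of_nonneg (fun x => sq_nonneg (u x)) hi).1 h0] with x hx
  exact pow_eq_zero_iff two_ne_zero |>.1 hx

lemma exists_orthonormalBasis_of_isosceles_right {A B C : E2}
    (hT : ¬ Collinear ℝ ({A, B, C} : Set E2))
    (hright : ∠ B A C = Real.pi / 2) (hlegs : dist A B = dist A C) :
    ∃ b : OrthonormalBasis (Fin 2) ℝ E2, ∃ a > (0 : ℝ), B = A + a • b 0 ∧ C = A + a • b 1 := by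
  have hAB : A ≠ B := by
    rintro rfl
    exact hT (by simpa using collinear_pair ℝ A C)
  have ha : 0 < dist A B := dist_pos.2 hAB
  have hB : ‖B - A‖ = dist A B := by rw [dist_comm, dist_eq_norm]
  have hC : ‖C - A‖ = dist A B := by rw [hlegs, dist_comm, dist_eq_norm]
  have hin : inner ℝ (B - A) (C - A) = 0 :=
    (InnerProductGeometry.inner_eq_zero_iff_angle_eq_pi_div_two _ _).2 hright
  have hon : Orthonormal ℝ ![(dist A B)⁻¹ • (B - A), (dist A B)⁻¹ • (C - A)] := by
    rw [orthonormal_vecCons_iff]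
    simp [norm_smul, hB, hC, hin, ha.ne', inner_smul_left, inner_smul_right, abs_of_pos ha,
      Orthonormal]
  obtain ⟨b, hb⟩ := Orthonormal.exists_orthonormalBasis_extension_of_card_eq (𝕜 := ℝ) (E := E2)
    (ι := Fin 2) (by simp) (s := univ) (hon.comp _ Subtype.val_injective)
  refine ⟨b, dist A B, ha, ?_, ?_⟩
  · simp [hb 0 trivial, smul_smul, ha.ne']
  · simp [hb 1 trivial, smul_smul, ha.ne']

lemma cartesianChart_inner (A : E2) (b : OrthonormalBasis (Fin 2) ℝ E2) (q : E2) :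
    cartesianChart A b (inner ℝ (b 0) (q - A), inner ℝ (b 1) (q - A)) = q := by
  have := b.sum_repr' (q - A)
  rw [Fin.sum_univ_two] at this
  rw [cartesianChart_apply, this, add_sub_cancel]

lemma inner_cartesianChart_sub (A : E2) (b : OrthonormalBasis (Fin 2) ℝ E2) (p : ℝ × ℝ) :
    inner ℝ (b 0) (cartesianChart A b p - A) = p.1 ∧
      inner ℝ (b 1) (cartesianChart A b p - A) = p.2 := by
  simp [cartesianChart_apply, inner_add_right, inner_smul_right, b.inner_eq_ite]

lemma cartesianChart_mem_triangleO (A : E2) (b : OrthonormalBasis (Fin 2) ℝ E2) {a : ℝ}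
    (ha : 0 < a) {p : ℝ × ℝ} (h1 : 0 < p.1) (h2 : 0 < p.2) (h3 : p.1 + p.2 < a) :
    cartesianChart A b p ∈ triangleO A (A + a • b 0) (A + a • b 1) := by
  refine mem_interior.2 ⟨{q | 0 < inner ℝ (b 0) (q - A)} ∩ ({q | 0 < inner ℝ (b 1) (q - A)} ∩
    {q | inner ℝ (b 0) (q - A) + inner ℝ (b 1) (q - A) < a}), ?_, ?_, ?_⟩
  · rintro q ⟨hq1, hq2, hq3⟩
    rw [← cartesianChart_inner A b q, cartesianChart_mem_convexHull A b ha]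
    exact ⟨le_of_lt hq1, le_of_lt hq2, le_of_lt hq3⟩
  · exact (isOpen_lt (by fun_prop) (by fun_prop)).inter
      ((isOpen_lt (by fun_prop) (by fun_prop)).inter (isOpen_lt (by fun_prop) (by fun_prop)))
  · obtain ⟨e1, e2⟩ := inner_cartesianChart_sub A b p
    simp only [mem_inter_iff, mem_ofPred_eq, e1, e2]
    exact ⟨h1, h2, h3⟩

/-- The first mixed eigenfunction of a right isosceles triangle. -/
def sinMulSin (A : E2) (b : OrthonormalBasis (Fin 2) ℝ E2) (k : ℝ) (q : E2) : ℝ :=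
  Real.sin (k * inner ℝ (b 0) (q - A)) * Real.sin (k * inner ℝ (b 1) (q - A))

lemma contDiff_sinMulSin (A : E2) (b : OrthonormalBasis (Fin 2) ℝ E2) (k : ℝ) :
    ContDiff ℝ (⊤ : ℕ∞) (sinMulSin A b k) := by
  have h (e : E2) : ContDiff ℝ (⊤ : ℕ∞) fun q : E2 => Real.sin (k * inner ℝ e (q - A)) :=
    (contDiff_const.mul (contDiff_const.inner ℝ (contDiff_id.sub contDiff_const))).sin
  exact (h (b 0)).mul (h (b 1))

lemma sinMulSin_cartesianChart (A : E2) (b : OrthonormalBasis (Fin 2) ℝ E2) (k : ℝ) (p : ℝ × ℝ) :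
    sinMulSin A b k (cartesianChart A b p) = Real.sin (k * p.1) * Real.sin (k * p.2) := by
  obtain ⟨e1, e2⟩ := inner_cartesianChart_sub A b p
  rw [sinMulSin, e1, e2]

lemma sinMulSin_eq_zero_of_mem_legs {A : E2} {b : OrthonormalBasis (Fin 2) ℝ E2} {a k : ℝ} {x : E2}
    (hx : x ∈ segment ℝ A (A + a • b 0) ∪ segment ℝ A (A + a • b 1)) :
    sinMulSin A b k x = 0 := by
  rcases hx with hx | hx <;> obtain ⟨t, rfl⟩ := exists_eq_add_smul_of_mem_segment hx <;>
    simp [sinMulSin, inner_smul_right, b.inner_eq_ite]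

lemma notAEZero_sinMulSin (A : E2) (b : OrthonormalBasis (Fin 2) ℝ E2) {a : ℝ} (ha : 0 < a) :
    NotAEZero (triangleO A (A + a • b 0) (A + a • b 1)) (sinMulSin A b (Real.pi / a)) := by
  intro h
  have h0 := Measure.eqOn_open_of_ae_eq (g := fun _ => 0) h isOpen_interior
    (contDiff_sinMulSin A b _).continuous.continuousOn continuousOn_const
    (cartesianChart_mem_triangleO A b ha (p := (a / 4, a / 4)) (by simp [ha]) (by simp [ha])
      (by simp only; linarith))
  have : 0 < Real.sin (Real.pi / a * (a / 4)) := by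
    have e : Real.pi / a * (a / 4) = Real.pi / 4 := by field_simp
    rw [e]
    exact Real.sin_pos_of_pos_of_lt_pi (by positivity) (by linarith [Real.pi_pos])
  rw [sinMulSin_cartesianChart] at h0
  exact (mul_pos this this).ne' h0

/-- The Dirichlet energy over the open triangle, in Cartesian coordinates along the legs. -/
lemma setIntegral_triangleO_norm_fderiv_sq (A : E2) (b : OrthonormalBasis (Fin 2) ℝ E2) {a : ℝ}
    (ha : 0 < a) (u : E2 → ℝ) :
    ∫ x in triangleO A (A + a • b 0) (A + a • b 1), ‖fderiv ℝ u x‖ ^ 2 =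
      ∫ p in stdTriangle a, (fderiv ℝ u (cartesianChart A b p) (b 0) ^ 2 +
        fderiv ℝ u (cartesianChart A b p) (b 1) ^ 2) := by
  rw [setIntegral_triangleO A b ha]
  simp_rw [b.norm_dual, Fin.sum_univ_two]

lemma rayleigh_sinMulSin (A : E2) (b : OrthonormalBasis (Fin 2) ℝ E2) {a : ℝ} (ha : 0 < a)
    (hpos : 0 < ∫ x in triangleO A (A + a • b 0) (A + a • b 1),
      sinMulSin A b (Real.pi / a) x ^ 2) :
    rayleigh (triangleO A (A + a • b 0) (A + a • b 1)) (sinMulSin A b (Real.pi / a)) =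
      2 * (Real.pi / a) ^ 2 := by
  rw [rayleigh, div_eq_iff hpos.ne', setIntegral_triangleO_norm_fderiv_sq A b ha,
    setIntegral_triangleO A b ha]
  simp_rw [sinMulSin_cartesianChart]
  rw [← setIntegral_stdTriangle_sin_mul_sin ha rfl]
  have hd := (contDiff_sinMulSin A b (Real.pi / a)).differentiable (by simp)
  have hs (c t : ℝ) : HasDerivAt (fun t => Real.sin (c * t)) (c * Real.cos (c * t)) t := by
    have hc : HasDerivAt (fun t => c * t) c t := by simpa using (hasDerivAt_id t).const_mul c
    exact hc.sin.congr_deriv (mul_comm _ _)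
  congr 1
  ext ⟨x, y⟩
  have hx := hasDerivAt_comp_cartesianChart_fst A b hd x y
  have hy := hasDerivAt_comp_cartesianChart_snd A b hd x y
  simp only [sinMulSin_cartesianChart] at hx hy
  rw [hx.unique ((hs _ x).mul_const _), hy.unique ((hs _ y).const_mul _)]
  ring

lemma isBounded_triangleO (A B C : E2) : Bornology.IsBounded (triangleO A B C) :=
  ((isBounded_convexHull (s := {A, B, C})).2 (Set.toFinite _).isBounded).subset interior_subset

lemma le_rayleigh (A : E2) (b : OrthonormalBasis (Fin 2) ℝ E2) {a : ℝ} (ha : 0 < a) {u : E2 → ℝ}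
    (hu : ContDiff ℝ (⊤ : ℕ∞) u)
    (h0 : ∀ x ∈ segment ℝ A (A + a • b 0) ∪ segment ℝ A (A + a • b 1), u x = 0)
    (hne : NotAEZero (triangleO A (A + a • b 0) (A + a • b 1)) u) :
    2 * (Real.pi / a) ^ 2 ≤ rayleigh (triangleO A (A + a • b 0) (A + a • b 1)) u := by
  rw [rayleigh, le_div_iff₀ (hne.setIntegral_sq_pos (isBounded_triangleO _ _ _) hu.continuous),
    setIntegral_triangleO_norm_fderiv_sq A b ha, setIntegral_triangleO A b ha]
  have hd := hu.differentiable (by simp)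
  have hc (e : E2) : Continuous fun p => fderiv ℝ u (cartesianChart A b p) e :=
    ((hu.continuous_fderiv (by simp)).comp (continuous_cartesianChart A b)).clm_apply
      continuous_const
  refine mixed_poincare_stdTriangle ha (v := fun p => u (cartesianChart A b p)) (hc (b 0))
    (hc (b 1)) (hu.continuous.comp (continuous_cartesianChart A b))
    (hasDerivAt_comp_cartesianChart_fst A b hd) (hasDerivAt_comp_cartesianChart_snd A b hd) ?_ ?_
  · intro y hy
    refine h0 _ (Or.inr ?_)
    simpa [cartesianChart_apply] using add_smul_mem_segment (A := A) (e := b 1) ha hy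
  · intro x hx
    refine h0 _ (Or.inl ?_)
    simpa [cartesianChart_apply] using add_smul_mem_segment (A := A) (e := b 0) ha hx

/-- For every isosceles right triangle `T* = △ABC` (right angle at `A`,
legs `AB`, `AC` of equal length), the first mixed eigenvalue with Dirichlet condition on the
two legs and Neumann condition on the hypotenuse equals `π²/|T*|`. -/
theorem stmt_2 (A B C : E2)
    (hT : ¬ Collinear ℝ ({A, B, C} : Set E2))
    (hright : ∠ B A C = Real.pi / 2) (hlegs : dist A B = dist A C) :
    firstMixedEig (triangleO A B C) (segment ℝ A B ∪ segment ℝ A C) =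
      Real.pi ^ 2 / area2 (convexHull ℝ ({A, B, C} : Set E2)) := by
  obtain ⟨b, a, ha, rfl, rfl⟩ := exists_orthonormalBasis_of_isosceles_right hT hright hlegs
  have hval : Real.pi ^ 2 / area2 (convexHull ℝ {A, A + a • b 0, A + a • b 1}) =
      2 * (Real.pi / a) ^ 2 := by
    rw [area2_convexHull A b ha, volume_real_stdTriangle ha.le]
    field_simp
  rw [hval]
  have hne := notAEZero_sinMulSin A b ha
  have hsm := contDiff_sinMulSin A b (Real.pi / a)
  refine IsLeast.csInf_eq ⟨⟨_, hsm, fun x hx => sinMulSin_eq_zero_of_mem_legs hx, hne, ?_⟩, ?_⟩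
  · exact (rayleigh_sinMulSin A b ha
      (hne.setIntegral_sq_pos (isBounded_triangleO _ _ _) hsm.continuous)).symm
  · rintro r ⟨u, hu, h0, hu0, rfl⟩
    exact le_rayleigh A b ha hu h0 hu0

end
end

section
/- Let T_R be a nondegenerate right triangle in ℝ² and let T_R* be an isosceles right triangle with the same area as T_R. Then λ₁^{L}(T_R) ≥ λ₁^{L}(T_R*), where in each triangle the Dirichlet condition is imposed on the hypotenuse (the longest side) and the Neumann condition on the two legs. -/
open MeasureTheory Set EuclideanGeometry

noncomputable section

lemma LipschitzWith.intervalIntegrable_deriv_sq {C : NNReal} {f : ℝ → ℝ} (hf : LipschitzWith C f)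
    (a b : ℝ) : IntervalIntegrable (fun x => deriv f x ^ 2) volume a b := by
  refine (intervalIntegrable_const (c := (C : ℝ) ^ 2)).mono_fun
    ((measurable_deriv f).pow_const 2).aestronglyMeasurable ?_
  refine Filter.Eventually.of_forall fun x => ?_
  have h := norm_deriv_le_of_lipschitz (x₀ := x) hf
  simp only [norm_pow, Real.norm_eq_abs, NNReal.abs_eq]
  exact pow_le_pow_left₀ (abs_nonneg _) h 2

/-- The one-dimensional Dirichlet inequality with a non-optimal constant, from a Riccati
substitution by a cotangent. -/
lemma sq_mul_integral_sq_le_of_lt {C : NNReal} {f : ℝ → ℝ} (hf : LipschitzWith C f) {p h k : ℝ}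
    (hk : 0 < k) (hkh : k * h < Real.pi)
    (hsupp : ∀ x, x ∉ Icc p (p + h) → f x = 0) :
    k ^ 2 * ∫ x, f x ^ 2 ≤ ∫ x, deriv f x ^ 2 := by
  obtain hh | hh := lt_or_ge h 0
  · have : f = fun _ => 0 := by
      funext x
      exact hsupp x (by rw [Icc_eq_empty (by linarith)]; simp)
    simp [this]
  set δ := (Real.pi / k - h) / 4 with hδ
  have hδ0 : 0 < δ := by
    have : h < Real.pi / k := by rw [lt_div_iff₀ hk]; linarith
    rw [hδ]; linarith
  have hδ1 : k * (h + 4 * δ) = Real.pi := by rw [hδ]; field_simp; ring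
  set a := p - δ with ha
  set b := p + h + δ with hb
  have hab : a ≤ b := by rw [ha, hb]; linarith
  have hderiv0 : ∀ x, x ∉ Icc p (p + h) → deriv f x = 0 := by
    intro x hx
    have : f =ᶠ[nhds x] fun _ => 0 := by
      filter_upwards [isClosed_Icc.isOpen_compl.mem_nhds hx] with y hy using hsupp y hy
    rw [this.deriv_eq]; simp
  have hfull : ∀ g : ℝ → ℝ, (∀ x, x ∉ Icc p (p + h) → g x = 0) → ∫ x, g x = ∫ x in a..b, g x := by
    intro g hg
    rw [intervalIntegral.integral_of_le hab]
    refine (setIntegral_eq_integral_of_forall_compl_eq_zero fun x hx => hg x fun hx' => hx ?_).symm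
    exact ⟨by rw [ha]; linarith [hx'.1], by rw [hb]; linarith [hx'.2]⟩
  rw [hfull _ (fun x hx => by simp [hsupp x hx]), hfull _ (fun x hx => by simp [hderiv0 x hx])]
  set c := p - 2 * δ with hc
  let φ : ℝ → ℝ := fun t => k * (Real.cos (k * (t - c)) / Real.sin (k * (t - c)))
  have hsin : ∀ t ∈ Icc a b, 0 < Real.sin (k * (t - c)) := by
    intro t ht
    apply Real.sin_pos_of_pos_of_lt_pi
    · exact mul_pos hk (by linarith [ht.1])
    · rw [← hδ1]
      exact mul_lt_mul_of_pos_left (by linarith [ht.2]) hk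
  have hφd : ∀ t ∈ Icc a b, HasDerivAt φ (-k ^ 2 - φ t ^ 2) t := by
    intro t ht
    have hs := (hsin t ht).ne'
    have h1 : HasDerivAt (fun t => k * (t - c)) k t := by
      simpa using ((hasDerivAt_id t).sub_const c).const_mul k
    have h2 := ((h1.cos).div h1.sin hs).const_mul k
    convert! h2 using 1
    simp only [φ]
    field_simp
  have hφc : ContDiffOn ℝ 1 φ (Icc a b) := by
    refine contDiffOn_const.mul (ContDiffOn.div ?_ ?_ fun t ht => (hsin t ht).ne') <;>
    · refine ContDiff.contDiffOn ?_
      fun_prop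
  obtain ⟨D, hD⟩ := hφc.exists_lipschitzOnWith (by norm_num) (convex_Icc a b) isCompact_Icc
  rw [← uIcc_of_le hab] at hD
  have hfac : AbsolutelyContinuousOnInterval f a b :=
    (hf.lipschitzOnWith (s := uIcc a b)).absolutelyContinuousOnInterval
  have hac := hD.absolutelyContinuousOnInterval.fun_mul (hfac.fun_mul hfac)
  have hzero : ∫ x in a..b, deriv (fun x => φ x * (f x * f x)) x = 0 := by
    rw [hac.integral_deriv_eq_sub, hsupp b (fun h => by linarith [h.2]),
      hsupp a (fun h => by linarith [h.1])]
    simp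
  have hI2 : IntervalIntegrable (fun x => f x ^ 2) volume a b :=
    (hf.continuous.pow 2).intervalIntegrable _ _
  have hI1 := hf.intervalIntegrable_deriv_sq a b
  have hmono : ∫ x in a..b, deriv (fun x => φ x * (f x * f x)) x ≤
      ∫ x in a..b, (deriv f x ^ 2 - k ^ 2 * f x ^ 2) := by
    refine intervalIntegral.integral_mono_ae_restrict hab hac.intervalIntegrable_deriv
      (hI1.sub (hI2.const_mul _)) ?_
    filter_upwards [ae_restrict_of_ae (hf.ae_differentiableAt (μ := volume)),
      ae_restrict_mem measurableSet_Icc] with x hx hxm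
    have hd := hx.hasDerivAt
    have hprod : deriv (fun x => φ x * (f x * f x)) x = _ := ((hφd x hxm).mul (hd.mul hd)).deriv
    simp only [Pi.mul_apply] at hprod
    rw [hprod]
    nlinarith [sq_nonneg (deriv f x - φ x * f x)]
  rw [hzero, intervalIntegral.integral_sub hI1 (hI2.const_mul _),
    intervalIntegral.integral_const_mul] at hmono
  linarith

/-- The sharp one-dimensional Dirichlet inequality for Lipschitz functions. -/
lemma sq_pi_div_mul_integral_sq_le {C : NNReal} {f : ℝ → ℝ} (hf : LipschitzWith C f) {p h : ℝ}
    (hh : 0 < h) (hsupp : ∀ x, x ∉ Icc p (p + h) → f x = 0) :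
    (Real.pi / h) ^ 2 * ∫ x, f x ^ 2 ≤ ∫ x, deriv f x ^ 2 := by
  have hcont : Filter.Tendsto (fun k : ℝ => k ^ 2 * ∫ x, f x ^ 2) (nhdsWithin (Real.pi / h)
      (Iio (Real.pi / h))) (nhds ((Real.pi / h) ^ 2 * ∫ x, f x ^ 2)) := by
    refine Filter.Tendsto.mono_left (Continuous.tendsto (by fun_prop) _) nhdsWithin_le_nhds
  refine le_of_tendsto hcont ?_
  have hpos : 0 < Real.pi / h := div_pos Real.pi_pos hh
  filter_upwards [self_mem_nhdsWithin, mem_nhdsWithin_of_mem_nhds (Ioi_mem_nhds hpos)] with k h1 h2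
  refine sq_mul_integral_sq_le_of_lt hf h2 ?_ hsupp
  rwa [mem_Iio, lt_div_iff₀ hh] at h1

/-- Cartesian coordinates as a measurable equivalence. -/
def coordEquiv : E2 ≃ᵐ ℝ × ℝ :=
  (MeasurableEquiv.toLp 2 (Fin 2 → ℝ)).symm.trans MeasurableEquiv.finTwoArrow

lemma coordEquiv_apply (p : E2) : coordEquiv p = (p 0, p 1) := rfl

lemma measurePreserving_coordEquiv : MeasurePreserving coordEquiv volume volume :=
  (volume_preserving_finTwoArrow ℝ).comp
    (EuclideanSpace.volume_preserving_symm_measurableEquiv_toLp (Fin 2))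

lemma coordEquiv_symm_apply (z : ℝ × ℝ) : coordEquiv.symm z = !₂[z.1, z.2] := by
  rw [MeasurableEquiv.symm_apply_eq, coordEquiv_apply]
  simp

lemma integral_eq_integral_prod (g : E2 → ℝ) : ∫ p, g p = ∫ z : ℝ × ℝ, g !₂[z.1, z.2] := by
  rw [← measurePreserving_coordEquiv.symm.integral_comp' g]
  simp only [coordEquiv_symm_apply]

lemma integrable_prod_of_integrable {g : E2 → ℝ} (hg : Integrable g) :
    Integrable (fun z : ℝ × ℝ => g !₂[z.1, z.2]) := by
  have := measurePreserving_coordEquiv.symm.integrable_comp_of_integrable hg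
  simpa only [Function.comp_def, coordEquiv_symm_apply] using this

lemma norm_sq_dual_eq (L : E2 →L[ℝ] ℝ) : ‖L‖ ^ 2 =
    L (EuclideanSpace.single 0 1) ^ 2 + L (EuclideanSpace.single 1 1) ^ 2 := by
  rw [(EuclideanSpace.basisFun (Fin 2) ℝ).norm_dual]
  simp

lemma lineDeriv_single_zero (W : E2 → ℝ) (x y : ℝ) :
    lineDeriv ℝ W !₂[x, y] (EuclideanSpace.single 0 1) = deriv (fun t => W !₂[t, y]) x := by
  have h : ∀ t : ℝ, !₂[x, y] + t • (EuclideanSpace.single 0 1 : E2) = !₂[x + t, y] := by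
    intro t
    ext i
    fin_cases i <;> simp
  simp only [lineDeriv, h]
  rw [deriv_comp_const_add (f := fun t => W !₂[t, y])]
  simp

lemma lineDeriv_single_one (W : E2 → ℝ) (x y : ℝ) :
    lineDeriv ℝ W !₂[x, y] (EuclideanSpace.single 1 1) = deriv (fun t => W !₂[x, t]) y := by
  have h : ∀ t : ℝ, !₂[x, y] + t • (EuclideanSpace.single 1 1 : E2) = !₂[x, y + t] := by
    intro t
    ext i
    fin_cases i <;> simp
  simp only [lineDeriv, h]
  rw [deriv_comp_const_add (f := fun t => W !₂[x, t])]
  simp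

lemma LipschitzWith.integrable_lineDeriv_sq {W : E2 → ℝ} {C : NNReal} (hW : LipschitzWith C W)
    (hcs : HasCompactSupport W) (v : E2) : Integrable (fun p => lineDeriv ℝ W p v ^ 2) := by
  have hm : AEStronglyMeasurable (fun p => lineDeriv ℝ W p v ^ 2) volume :=
    ((measurable_lineDeriv hW.continuous).pow_const 2).aestronglyMeasurable
  rw [← integrableOn_iff_integrable_of_support_subset (s := tsupport W)]
  · refine Measure.integrableOn_of_bounded hcs.isCompact.measure_lt_top.ne hm
      (M := (C * ‖v‖) ^ 2) (Filter.Eventually.of_forall fun p => ?_)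
    rw [norm_pow]
    exact pow_le_pow_left₀ (norm_nonneg _) (norm_lineDeriv_le_of_lipschitz ℝ hW) 2
  · intro p hp
    by_contra hp'
    refine hp ?_
    have h : W =ᶠ[nhds p] fun _ => 0 := notMem_tsupport_iff_eventuallyEq.mp hp'
    simp only [h.lineDeriv_eq]
    simp [lineDeriv]

lemma LipschitzWith.integrable_sq {W : E2 → ℝ} {C : NNReal} (hW : LipschitzWith C W)
    (hcs : HasCompactSupport W) : Integrable (fun p => W p ^ 2) := by
  have hc : Continuous fun p => W p ^ 2 := hW.continuous.pow 2
  refine hc.integrable_of_hasCompactSupport (hcs.mono fun p hp h => hp ?_)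
  simp [h]

lemma LipschitzWith.norm_fderiv_sq_ae {W : E2 → ℝ} {C : NNReal} (hW : LipschitzWith C W) :
    ∀ᵐ p, ‖fderiv ℝ W p‖ ^ 2 = lineDeriv ℝ W p (EuclideanSpace.single 0 1) ^ 2 +
      lineDeriv ℝ W p (EuclideanSpace.single 1 1) ^ 2 := by
  filter_upwards [hW.ae_differentiableAt (μ := volume)] with p hp
  rw [norm_sq_dual_eq, hp.lineDeriv_eq_fderiv, hp.lineDeriv_eq_fderiv]

lemma LipschitzWith.integrable_norm_fderiv_sq {W : E2 → ℝ} {C : NNReal} (hW : LipschitzWith C W)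
    (hcs : HasCompactSupport W) : Integrable (fun p => ‖fderiv ℝ W p‖ ^ 2) :=
  ((hW.integrable_lineDeriv_sq hcs _).add (hW.integrable_lineDeriv_sq hcs _)).congr
    (hW.norm_fderiv_sq_ae.mono fun _ h => h.symm)

/-- If all horizontal and vertical slices of the support of `W` are contained in intervals of
length `s` and `h`, then the Dirichlet energy is bounded below as on an `s × h` rectangle. -/
lemma LipschitzWith.rect_mul_integral_sq_le {W : E2 → ℝ} {C : NNReal} (hW : LipschitzWith C W)
    (hcs : HasCompactSupport W) {s h : ℝ} (hs : 0 < s) (hh : 0 < h)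
    (hx : ∀ y, ∃ p, ∀ x, x ∉ Icc p (p + s) → W !₂[x, y] = 0)
    (hy : ∀ x, ∃ p, ∀ y, y ∉ Icc p (p + h) → W !₂[x, y] = 0) :
    ((Real.pi / s) ^ 2 + (Real.pi / h) ^ 2) * ∫ p, W p ^ 2 ≤ ∫ p, ‖fderiv ℝ W p‖ ^ 2 := by
  have i0 := hW.integrable_lineDeriv_sq hcs (EuclideanSpace.single 0 1)
  have i1 := hW.integrable_lineDeriv_sq hcs (EuclideanSpace.single 1 1)
  have i2 := hW.integrable_sq hcs
  have j0 := integrable_prod_of_integrable i0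
  have j1 := integrable_prod_of_integrable i1
  have j2 := integrable_prod_of_integrable i2
  have key0 : (Real.pi / s) ^ 2 * ∫ p, W p ^ 2 ≤
      ∫ p, lineDeriv ℝ W p (EuclideanSpace.single 0 1) ^ 2 := by
    rw [integral_eq_integral_prod, integral_eq_integral_prod, Measure.volume_eq_prod,
      integral_prod_symm _ j2, integral_prod_symm _ j0, ← integral_const_mul]
    refine integral_mono (j2.integral_prod_right.const_mul _) j0.integral_prod_right fun y => ?_
    obtain ⟨p, hp⟩ := hx y
    simp only [lineDeriv_single_zero]
    refine sq_pi_div_mul_integral_sq_le (C := C) (LipschitzWith.of_dist_le_mul fun a b => ?_) hs hp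
    refine (hW.dist_le_mul _ _).trans_eq ?_
    simp [EuclideanSpace.dist_eq, Real.sqrt_sq]
  have key1 : (Real.pi / h) ^ 2 * ∫ p, W p ^ 2 ≤
      ∫ p, lineDeriv ℝ W p (EuclideanSpace.single 1 1) ^ 2 := by
    rw [integral_eq_integral_prod, integral_eq_integral_prod, Measure.volume_eq_prod,
      integral_prod _ j2, integral_prod _ j1, ← integral_const_mul]
    refine integral_mono (j2.integral_prod_left.const_mul _) j1.integral_prod_left fun x => ?_
    obtain ⟨p, hp⟩ := hy x
    simp only [lineDeriv_single_one]
    refine sq_pi_div_mul_integral_sq_le (C := C) (LipschitzWith.of_dist_le_mul fun a b => ?_) hh hp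
    refine (hW.dist_le_mul _ _).trans_eq ?_
    simp [EuclideanSpace.dist_eq, Real.sqrt_sq]
  rw [integral_congr_ae hW.norm_fderiv_sq_ae, integral_add i0 i1, add_mul]
  exact add_le_add key0 key1

lemma exists_linearIsometryEquiv_of_orthonormal (e n : E2) (he : ‖e‖ = 1) (hn : ‖n‖ = 1)
    (hen : inner ℝ e n = 0) :
    ∃ L : E2 ≃ₗᵢ[ℝ] E2, ∀ p, L p = p 0 • e + p 1 • n := by
  have ho : Orthonormal ℝ ((univ : Set (Fin 2)).domRestrict ![e, n]) := by
    have h : Orthonormal ℝ ![e, n] := by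
      simp [orthonormal_vecCons_iff, he, hn, hen]
    exact h.comp _ Subtype.val_injective
  obtain ⟨b, hb⟩ := ho.exists_orthonormalBasis_extension_of_card_eq (by simp)
  refine ⟨b.repr.symm, fun p => ?_⟩
  rw [← b.sum_repr_symm, Fin.sum_univ_two, hb 0 (mem_univ _), hb 1 (mem_univ _)]
  rfl

lemma norm_fderiv_comp_isometry (u : E2 → ℝ) (A : E2) (L : E2 ≃ₗᵢ[ℝ] E2) (p : E2) :
    ‖fderiv ℝ (fun q => u (A + L q)) p‖ = ‖fderiv ℝ u (A + L p)‖ := by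
  have h : (fun q => u (A + L q)) = (fun q => u (A + q)) ∘ L.toContinuousLinearEquiv := rfl
  rw [h, ContinuousLinearEquiv.comp_right_fderiv, fderiv_comp_add_left]
  exact ContinuousLinearMap.opNorm_comp_linearIsometryEquiv _ L

/-- The closed right triangle with legs `a` and `b` along the coordinate axes. -/
def stdTri (a b : ℝ) : Set E2 := {p | 0 ≤ p 0 ∧ 0 ≤ p 1 ∧ p 0 / a + p 1 / b ≤ 1}

lemma convex_stdTri {a b : ℝ} : Convex ℝ (stdTri a b) := by
  rintro p ⟨h1, h2, h3⟩ q ⟨k1, k2, k3⟩ s t hs ht hst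
  refine ⟨?_, ?_, ?_⟩
  · simp only [PiLp.add_apply, PiLp.smul_apply, smul_eq_mul]; positivity
  · simp only [PiLp.add_apply, PiLp.smul_apply, smul_eq_mul]; positivity
  · simp only [PiLp.add_apply, PiLp.smul_apply, smul_eq_mul]
    calc (s * p 0 + t * q 0) / a + (s * p 1 + t * q 1) / b
        = s * (p 0 / a + p 1 / b) + t * (q 0 / a + q 1 / b) := by ring
      _ ≤ s * 1 + t * 1 := by gcongr
      _ = 1 := by linarith

lemma convexHull_eq_stdTri {a b : ℝ} (ha : 0 < a) (hb : 0 < b) :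
    convexHull ℝ ({0, !₂[a, 0], !₂[0, b]} : Set E2) = stdTri a b := by
  apply Subset.antisymm
  · refine convexHull_min ?_ convex_stdTri
    rintro p (rfl | rfl | rfl)
    · simp [stdTri]
    · simp [stdTri, ha.le, ha.ne']
    · simp [stdTri, hb.le, hb.ne']
  · rintro p ⟨h1, h2, h3⟩
    have hp : p = ∑ i : Fin 3, (![1 - (p 0 / a + p 1 / b), p 0 / a, p 1 / b] i) •
        ((![0, !₂[a, 0], !₂[0, b]] : Fin 3 → E2) i) := by
      rw [Fin.sum_univ_three]
      ext i
      fin_cases i <;> simp [ha.ne', hb.ne']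
    rw [hp]
    refine (convex_convexHull ℝ _).sum_mem (fun i _ => ?_) ?_ fun i _ => subset_convexHull ℝ _ ?_
    · fin_cases i
      · simpa using h3
      · simpa using div_nonneg h1 ha.le
      · simpa using div_nonneg h2 hb.le
    · rw [Fin.sum_univ_three]
      simp only [Matrix.cons_val]
      ring
    · fin_cases i <;> simp

lemma isCompact_stdTri {a b : ℝ} (ha : 0 < a) (hb : 0 < b) : IsCompact (stdTri a b) := by
  rw [← convexHull_eq_stdTri ha hb]
  exact (by simp : ({0, !₂[a, 0], !₂[0, b]} : Set E2).Finite).isCompact_convexHull ℝ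

/-- The open first quadrant. -/
def openQuadrant : Set E2 := {p | 0 < p 0 ∧ 0 < p 1}

lemma interior_stdTri_subset (a b : ℝ) : interior (stdTri a b) ⊆ openQuadrant := by
  have key : ∀ i : Fin 2, interior {p : E2 | 0 ≤ p i} ⊆ {p | 0 < p i} := by
    intro i p hp
    have hop : IsOpenMap (fun p : E2 => p i) := by
      refine (isOpenMap_eval i).comp (EuclideanSpace.equiv (Fin 2) ℝ).toHomeomorph.isOpenMap
    have := hop.interior_preimage_subset_preimage_interior (s := Ici (0 : ℝ)) hp
    simpa using this
  intro p hp
  exact ⟨key 0 (interior_mono (fun q hq => hq.1) hp), key 1 (interior_mono (fun q hq => hq.2.1) hp)⟩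

/-- Coordinatewise absolute value. -/
def absMap (p : E2) : E2 := !₂[|p 0|, |p 1|]

lemma dist_absMap_le (p q : E2) : dist (absMap p) (absMap q) ≤ dist p q := by
  rw [EuclideanSpace.dist_eq, EuclideanSpace.dist_eq]
  refine Real.sqrt_le_sqrt (Finset.sum_le_sum fun i _ => ?_)
  refine pow_le_pow_left₀ dist_nonneg ?_ 2
  fin_cases i <;> simpa [absMap, Real.dist_eq] using abs_abs_sub_abs_le _ _

lemma absMap_of_nonneg {p : E2} (h0 : 0 ≤ p 0) (h1 : 0 ≤ p 1) : absMap p = p := by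
  ext i
  fin_cases i <;> simp [absMap, abs_of_nonneg, h0, h1]

lemma exists_reflection (p : E2) :
    ∃ σ : E2 ≃ₗᵢ[ℝ] E2, σ p = absMap p ∧ ∀ q, absMap (σ q) = absMap q := by
  have hs : ∀ x : ℝ, ∃ s : ℝ, |s| = 1 ∧ s * x = |x| := by
    intro x
    obtain h | h := le_total 0 x
    · exact ⟨1, by simp, by rw [abs_of_nonneg h, one_mul]⟩
    · exact ⟨-1, by simp, by rw [abs_of_nonpos h]; ring⟩
  obtain ⟨s, hs1, hs2⟩ := hs (p 0)
  obtain ⟨t, ht1, ht2⟩ := hs (p 1)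
  obtain ⟨σ, hσ⟩ := exists_linearIsometryEquiv_of_orthonormal !₂[s, 0] !₂[0, t]
    (by simp [EuclideanSpace.norm_eq, Real.sqrt_sq_eq_abs, hs1])
    (by simp [EuclideanSpace.norm_eq, Real.sqrt_sq_eq_abs, ht1])
    (by simp [PiLp.inner_apply])
  refine ⟨σ, ?_, fun q => ?_⟩
  · rw [hσ]
    ext i
    fin_cases i
    · simpa [absMap, mul_comm] using hs2
    · simpa [absMap, mul_comm] using ht2
  · rw [hσ]
    ext i
    fin_cases i <;> simp [absMap, abs_mul, hs1, ht1]

/-- The extension of `u` from the standard triangle to the rhombus obtained by reflection across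
the legs, and by zero elsewhere. -/
def foldExt (a b : ℝ) (u : E2 → ℝ) (p : E2) : ℝ := (stdTri a b).indicator u (absMap p)

lemma foldExt_eq_zero {a b : ℝ} {u : E2 → ℝ} {p : E2} (h : 1 < |p 0| / a + |p 1| / b) :
    foldExt a b u p = 0 := by
  refine indicator_of_notMem (fun hp => ?_) _
  have := hp.2.2
  simp only [absMap, PiLp.toLp_apply, Matrix.cons_val_zero, Matrix.cons_val_one] at this
  linarith

lemma exists_lipschitzWith_foldExt {a b : ℝ} (ha : 0 < a) (hb : 0 < b) {u : E2 → ℝ}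
    (hu : ContDiff ℝ (⊤ : ℕ∞) u) (hD : ∀ p ∈ stdTri a b, p 0 / a + p 1 / b = 1 → u p = 0) :
    ∃ C, LipschitzWith C (foldExt a b u) := by
  obtain ⟨C, hC⟩ := (hu.contDiffOn (s := stdTri a b)).exists_lipschitzOnWith (by simp)
    convex_stdTri (isCompact_stdTri ha hb)
  have cross : ∀ p q : E2, p ∈ stdTri a b → q ∉ stdTri a b → 0 ≤ q 0 → 0 ≤ q 1 →
      |u p| ≤ C * dist p q := by
    intro p q hp hq hq0 hq1
    have hβ : 1 < q 0 / a + q 1 / b := by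
      by_contra hcon
      exact hq ⟨hq0, hq1, not_lt.mp hcon⟩
    have hα := hp.2.2
    set α := p 0 / a + p 1 / b with hαd
    set β := q 0 / a + q 1 / b with hβd
    set t := (1 - α) / (β - α) with ht
    have hne : 0 < β - α := by linarith
    have ht0 : 0 ≤ t := div_nonneg (by linarith) hne.le
    have ht1 : t ≤ 1 := by rw [ht, div_le_one hne]; linarith
    set r := AffineMap.lineMap p q t with hr
    have hri : ∀ i, r i = (1 - t) * p i + t * q i := by
      intro i
      simp only [hr, AffineMap.lineMap_apply, vsub_eq_sub, vadd_eq_add, PiLp.add_apply,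
        PiLp.smul_apply, PiLp.sub_apply, smul_eq_mul]
      ring
    have hr1 : r 0 / a + r 1 / b = 1 := by
      have h1 : r 0 / a + r 1 / b = α + t * (β - α) := by
        rw [hri, hri, hαd, hβd]; ring
      rw [h1, ht, div_mul_cancel₀ _ hne.ne']; ring
    have hrT : r ∈ stdTri a b := by
      refine ⟨?_, ?_, hr1.le⟩ <;> rw [hri]
      · exact add_nonneg (mul_nonneg (by linarith) hp.1) (mul_nonneg ht0 hq0)
      · exact add_nonneg (mul_nonneg (by linarith) hp.2.1) (mul_nonneg ht0 hq1)
    have h2 := hC.dist_le_mul p hp r hrT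
    rw [hD r hrT hr1, Real.dist_eq, sub_zero, hr, dist_left_lineMap, Real.norm_of_nonneg ht0] at h2
    refine h2.trans (mul_le_mul_of_nonneg_left ?_ C.2)
    exact mul_le_of_le_one_left dist_nonneg ht1
  refine ⟨C, LipschitzWith.of_dist_le_mul fun p q => ?_⟩
  refine le_trans ?_ (mul_le_mul_of_nonneg_left (dist_absMap_le p q) C.2)
  have hn0 : ∀ p, 0 ≤ absMap p 0 := fun p => by simp [absMap]
  have hn1 : ∀ p, 0 ≤ absMap p 1 := fun p => by simp [absMap]
  unfold foldExt
  by_cases h1 : absMap p ∈ stdTri a b <;> by_cases h2 : absMap q ∈ stdTri a b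
  · rw [indicator_of_mem h1, indicator_of_mem h2]
    exact hC.dist_le_mul _ h1 _ h2
  · rw [indicator_of_mem h1, indicator_of_notMem h2, Real.dist_eq, sub_zero]
    exact cross _ _ h1 h2 (hn0 q) (hn1 q)
  · rw [indicator_of_notMem h1, indicator_of_mem h2, Real.dist_eq, zero_sub, abs_neg, dist_comm]
    exact cross _ _ h2 h1 (hn0 p) (hn1 p)
  · rw [indicator_of_notMem h1, indicator_of_notMem h2, dist_self]
    exact mul_nonneg C.2 dist_nonneg

lemma hasCompactSupport_foldExt {a b : ℝ} (ha : 0 < a) (hb : 0 < b) (u : E2 → ℝ) :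
    HasCompactSupport (foldExt a b u) := by
  refine HasCompactSupport.intro (isCompact_closedBall (0 : E2) (a + b)) fun p hp => ?_
  refine foldExt_eq_zero ?_
  by_contra hcon
  rw [not_lt] at hcon
  have h0 : |p 0| / a ≤ 1 := by have : 0 ≤ |p 1| / b := by positivity
                                linarith
  have h1 : |p 1| / b ≤ 1 := by have : 0 ≤ |p 0| / a := by positivity
                                linarith
  rw [div_le_one ha] at h0
  rw [div_le_one hb] at h1
  refine hp ?_
  rw [mem_closedBall_zero_iff, EuclideanSpace.norm_eq, Fin.sum_univ_two]
  refine Real.sqrt_le_iff.mpr ⟨by positivity, ?_⟩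
  simp only [Real.norm_eq_abs]
  nlinarith [abs_nonneg (p 0), abs_nonneg (p 1)]

lemma measurableSet_openQuadrant : MeasurableSet openQuadrant := by
  have h : ∀ i : Fin 2, Measurable fun p : E2 => p i := fun i => by fun_prop
  exact (measurableSet_lt measurable_const (h 0)).inter (measurableSet_lt measurable_const (h 1))

lemma integral_eq_four_mul_of_even {g : E2 → ℝ} (hg : Integrable g) (heven : ∀ p, g (absMap p) = g p) :
    ∫ p, g p = 4 * ∫ p in openQuadrant, g p := by
  have hj := integrable_prod_of_integrable hg
  have hpre : openQuadrant = coordEquiv ⁻¹' (Ioi 0 ×ˢ Ioi 0) := by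
    ext p; simp [openQuadrant, coordEquiv_apply]
  have hq : ∫ p in openQuadrant, g p = ∫ x in Ioi (0 : ℝ), ∫ y in Ioi (0 : ℝ), g !₂[x, y] := by
    have h1 := measurePreserving_coordEquiv.setIntegral_preimage_emb
      coordEquiv.measurableEmbedding (fun z : ℝ × ℝ => g !₂[z.1, z.2]) (Ioi 0 ×ˢ Ioi 0)
    have h2 : ∀ p : E2, !₂[(coordEquiv p).1, (coordEquiv p).2] = p := fun p => by
      ext i; fin_cases i <;> simp [coordEquiv_apply]
    simp only [h2] at h1
    rw [hpre, h1, Measure.volume_eq_prod, setIntegral_prod _ hj.integrableOn]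
  have hab : ∀ x y : ℝ, g !₂[x, y] = g !₂[|x|, |y|] := fun x y => by
    rw [← heven]; simp [absMap]
  rw [hq, integral_eq_integral_prod, Measure.volume_eq_prod, integral_prod _ hj]
  have hin : ∀ x : ℝ, ∫ y, g !₂[x, y] = 2 * ∫ y in Ioi (0 : ℝ), g !₂[|x|, y] := by
    intro x
    rw [← integral_comp_abs (f := fun y => g !₂[|x|, y])]
    simp only [← hab]
  simp only [hin]
  rw [integral_const_mul, integral_comp_abs (f := fun x => ∫ y in Ioi (0 : ℝ), g !₂[x, y])]
  ring

lemma norm_fderiv_foldExt_absMap (a b : ℝ) (u : E2 → ℝ) (p : E2) :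
    ‖fderiv ℝ (foldExt a b u) (absMap p)‖ = ‖fderiv ℝ (foldExt a b u) p‖ := by
  obtain ⟨σ, h1, h2⟩ := exists_reflection p
  have h := norm_fderiv_comp_isometry (foldExt a b u) 0 σ p
  have h3 : (fun q => foldExt a b u (0 + σ q)) = foldExt a b u := by
    funext q
    simp only [foldExt, zero_add, h2]
  rw [h3, zero_add, h1] at h
  exact h.symm

lemma foldExt_absMap (a b : ℝ) (u : E2 → ℝ) (p : E2) :
    foldExt a b u (absMap p) = foldExt a b u p := by
  simp [foldExt, absMap]

lemma foldExt_of_mem {a b : ℝ} {u : E2 → ℝ} {p : E2} (hp : p ∈ stdTri a b) :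
    foldExt a b u p = u p := by
  rw [foldExt, absMap_of_nonneg hp.1 hp.2.1, indicator_of_mem hp]

lemma setIntegral_openQuadrant_eq {a b : ℝ} (ha : 0 < a) (hb : 0 < b) {g k : E2 → ℝ}
    (h0 : ∀ p ∈ openQuadrant \ stdTri a b, g p = 0) (h1 : ∀ p ∈ interior (stdTri a b), g p = k p) :
    ∫ p in openQuadrant, g p = ∫ p in interior (stdTri a b), k p := by
  rw [← setIntegral_congr_fun isOpen_interior.measurableSet h1]
  refine setIntegral_eq_of_subset_of_ae_sdiff_eq_zero (μ := volume) (f := g)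
    measurableSet_openQuadrant.nullMeasurableSet (interior_stdTri_subset a b) ?_
  have hfr := (convex_stdTri (a := a) (b := b)).addHaar_frontier volume
  filter_upwards [measure_eq_zero_iff_ae_notMem.mp hfr] with p hp hpm
  refine h0 p ⟨hpm.1, fun hpT => hp ?_⟩
  rw [(isCompact_stdTri ha hb).isClosed.frontier_eq]
  exact ⟨hpT, hpm.2⟩

lemma integral_foldExt_sq {a b : ℝ} (ha : 0 < a) (hb : 0 < b) {u : E2 → ℝ} {C : NNReal}
    (hV : LipschitzWith C (foldExt a b u)) :
    ∫ p, foldExt a b u p ^ 2 = 4 * ∫ p in interior (stdTri a b), u p ^ 2 := by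
  rw [integral_eq_four_mul_of_even (hV.integrable_sq (hasCompactSupport_foldExt ha hb u))
    (fun p => by rw [foldExt_absMap]), setIntegral_openQuadrant_eq ha hb]
  · rintro p ⟨hp, hpT⟩
    rw [foldExt, absMap_of_nonneg hp.1.le hp.2.le, indicator_of_notMem hpT]
    simp
  · intro p hp
    rw [foldExt_of_mem (interior_subset hp)]

lemma integral_norm_fderiv_foldExt_sq {a b : ℝ} (ha : 0 < a) (hb : 0 < b) {u : E2 → ℝ}
    {C : NNReal} (hV : LipschitzWith C (foldExt a b u)) :
    ∫ p, ‖fderiv ℝ (foldExt a b u) p‖ ^ 2 =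
      4 * ∫ p in interior (stdTri a b), ‖fderiv ℝ u p‖ ^ 2 := by
  rw [integral_eq_four_mul_of_even (hV.integrable_norm_fderiv_sq (hasCompactSupport_foldExt ha hb u))
    (fun p => by rw [norm_fderiv_foldExt_absMap]), setIntegral_openQuadrant_eq ha hb]
  · rintro p ⟨hp, hpT⟩
    have hcont : ∀ i : Fin 2, Continuous fun p : E2 => p i := fun i => by fun_prop
    have h : foldExt a b u =ᶠ[nhds p] fun _ => 0 := by
      filter_upwards [(isCompact_stdTri ha hb).isClosed.isOpen_compl.mem_nhds hpT,
        (hcont 0).continuousAt.eventually (lt_mem_nhds hp.1),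
        (hcont 1).continuousAt.eventually (lt_mem_nhds hp.2)] with q hq h0 h1
      rw [foldExt, absMap_of_nonneg h0.le h1.le, indicator_of_notMem hq]
    rw [h.fderiv_eq]
    simp
  · intro p hp
    have h : foldExt a b u =ᶠ[nhds p] u := by
      filter_upwards [isOpen_interior.mem_nhds hp] with q hq
      exact foldExt_of_mem (interior_subset hq)
    rw [h.fderiv_eq]

/-- The lower bound: the Dirichlet energy on a right triangle with legs `a` and `b`, for functions
vanishing on the hypotenuse. -/
lemma stdTri_energy_ge {a b : ℝ} (ha : 0 < a) (hb : 0 < b) {u : E2 → ℝ}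
    (hu : ContDiff ℝ (⊤ : ℕ∞) u) (hD : ∀ p ∈ stdTri a b, p 0 / a + p 1 / b = 1 → u p = 0) :
    Real.pi ^ 2 / (a * b) * ∫ p in interior (stdTri a b), u p ^ 2 ≤
      ∫ p in interior (stdTri a b), ‖fderiv ℝ u p‖ ^ 2 := by
  obtain ⟨C, hV⟩ := exists_lipschitzWith_foldExt ha hb hu hD
  have hcs := hasCompactSupport_foldExt ha hb u
  set V := foldExt a b u with hVdef
  set c := Real.sqrt (a ^ 2 + b ^ 2) with hc
  have hc0 : 0 < c := Real.sqrt_pos.mpr (by positivity)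
  have hc2 : c ^ 2 = a ^ 2 + b ^ 2 := Real.sq_sqrt (by positivity)
  obtain ⟨ρ, hρ⟩ := exists_linearIsometryEquiv_of_orthonormal !₂[a / c, -b / c] !₂[b / c, a / c]
    (by
      rw [EuclideanSpace.norm_eq, Real.sqrt_eq_one, Fin.sum_univ_two]
      simp only [Real.norm_eq_abs, sq_abs, Matrix.cons_val_zero, Matrix.cons_val_one]
      field_simp; linarith)
    (by
      rw [EuclideanSpace.norm_eq, Real.sqrt_eq_one, Fin.sum_univ_two]
      simp only [Real.norm_eq_abs, sq_abs, Matrix.cons_val_zero, Matrix.cons_val_one]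
      field_simp; linarith)
    (by simp [PiLp.inner_apply]; ring)
  have hWL : LipschitzWith C (fun p => V (ρ p)) := by
    have h := hV.comp ρ.isometry.lipschitz
    rw [mul_one] at h
    exact h
  have hWcs : HasCompactSupport (fun p => V (ρ p)) := hcs.comp_homeomorph ρ.toHomeomorph
  have hW0 : ∀ X Y : ℝ, V (ρ !₂[X, Y]) ≠ 0 →
      |Y| ≤ a * b / c ∧ |2 * X + Y * (b / a - a / b)| ≤ c := by
    intro X Y hne
    have h1 : |(ρ !₂[X, Y]) 0| / a + |(ρ !₂[X, Y]) 1| / b ≤ 1 := by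
      by_contra hcon
      exact hne (foldExt_eq_zero (not_le.mp hcon))
    have e0 : (ρ !₂[X, Y]) 0 = (a * X + b * Y) / c := by
      rw [hρ]; simp; ring
    have e1 : (ρ !₂[X, Y]) 1 = (a * Y - b * X) / c := by
      rw [hρ]; simp; ring
    set x := (ρ !₂[X, Y]) 0
    set y := (ρ !₂[X, Y]) 1
    have hx : |x| / a = |x / a| := by rw [abs_div, abs_of_pos ha]
    have hy : |y| / b = |y / b| := by rw [abs_div, abs_of_pos hb]
    rw [hx, hy] at h1
    have s1 : |x / a + y / b| ≤ 1 := (abs_add_le _ _).trans h1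
    have s2 : |x / a - y / b| ≤ 1 := (abs_sub _ _).trans h1
    have t1 : x / a + y / b = Y / (a * b / c) := by
      rw [e0, e1]; field_simp; rw [hc2]; ring
    have t2 : x / a - y / b = (2 * X + Y * (b / a - a / b)) / c := by
      rw [e0, e1]; field_simp; ring
    have habc : 0 < a * b / c := by positivity
    rw [t1, abs_div, abs_of_pos habc, div_le_one habc] at s1
    rw [t2, abs_div, abs_of_pos hc0, div_le_one hc0] at s2
    exact ⟨s1, s2⟩
  have hh : 0 < 2 * (a * b / c) := by positivity
  have key := hWL.rect_mul_integral_sq_le hWcs hc0 hh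
    (fun Y => ⟨-(c / 2) - Y * (b / a - a / b) / 2, fun X hX => by
      by_contra hne
      have := abs_le.mp (hW0 X Y hne).2
      exact hX ⟨by linarith [this.1], by linarith [this.2]⟩⟩)
    (fun X => ⟨-(a * b / c), fun Y hY => by
      by_contra hne
      have := abs_le.mp (hW0 X Y hne).1
      exact hY ⟨by linarith [this.1], by linarith [this.2]⟩⟩)
  have hi1 : ∫ p, V (ρ p) ^ 2 = ∫ p, V p ^ 2 :=
    ρ.measurePreserving.integral_comp ρ.toHomeomorph.measurableEmbedding (fun p => V p ^ 2)
  have hi2 : ∫ p, ‖fderiv ℝ (fun q => V (ρ q)) p‖ ^ 2 = ∫ p, ‖fderiv ℝ V p‖ ^ 2 := by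
    have h : ∀ p, ‖fderiv ℝ (fun q => V (ρ q)) p‖ = ‖fderiv ℝ V (ρ p)‖ := fun p => by
      simpa using norm_fderiv_comp_isometry V 0 ρ p
    simp only [h]
    exact ρ.measurePreserving.integral_comp ρ.toHomeomorph.measurableEmbedding
      (fun p => ‖fderiv ℝ V p‖ ^ 2)
  rw [hi1, hi2, integral_foldExt_sq ha hb hV, integral_norm_fderiv_foldExt_sq ha hb hV] at key
  have hnn : 0 ≤ ∫ p in interior (stdTri a b), u p ^ 2 := integral_nonneg fun p => sq_nonneg _
  have hAM : Real.pi ^ 2 / (a * b) ≤ (Real.pi / c) ^ 2 + (Real.pi / (2 * (a * b / c))) ^ 2 := by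
    have h : (Real.pi / c) ^ 2 + (Real.pi / (2 * (a * b / c))) ^ 2 - Real.pi ^ 2 / (a * b) =
        (Real.pi / c - Real.pi / (2 * (a * b / c))) ^ 2 := by
      field_simp; ring
    linarith [sq_nonneg (Real.pi / c - Real.pi / (2 * (a * b / c)))]
  have := mul_le_mul_of_nonneg_right hAM hnn
  linarith

lemma setIntegral_stdTri {a b : ℝ} (ha : 0 < a) (hb : 0 < b) {f : E2 → ℝ} (hf : Continuous f) :
    ∫ p in stdTri a b, f p =
      ∫ x in (0 : ℝ)..a, ∫ y in (0 : ℝ)..b * (1 - x / a), f !₂[x, y] := by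
  have hT := isCompact_stdTri ha hb
  have hi : Integrable ((stdTri a b).indicator f) :=
    (integrable_indicator_iff hT.measurableSet).mpr (hf.continuousOn.integrableOn_compact hT)
  have hj := integrable_prod_of_integrable hi
  rw [← integral_indicator hT.measurableSet, integral_eq_integral_prod, Measure.volume_eq_prod,
    integral_prod _ hj, intervalIntegral.integral_of_le ha.le, ← integral_Icc_eq_integral_Ioc,
    ← integral_indicator measurableSet_Icc]
  congr 1
  funext x
  have hmem : ∀ y, !₂[x, y] ∈ stdTri a b ↔ x ∈ Icc 0 a ∧ y ∈ Icc 0 (b * (1 - x / a)) := by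
    intro y
    have hy : x / a + y / b ≤ 1 ↔ y ≤ b * (1 - x / a) := by
      rw [← le_sub_iff_add_le', div_le_iff₀' hb]
    simp only [stdTri, mem_ofPred_eq, Matrix.cons_val_zero, Matrix.cons_val_one,
      hy, mem_Icc]
    constructor
    · rintro ⟨h1, h2, h3⟩
      refine ⟨⟨h1, ?_⟩, h2, h3⟩
      have : 0 ≤ 1 - x / a := nonneg_of_mul_nonneg_right (h2.trans h3) hb
      rw [sub_nonneg, div_le_one ha] at this
      exact this
    · rintro ⟨⟨h1, _⟩, h2, h3⟩
      exact ⟨h1, h2, h3⟩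
  by_cases hx : x ∈ Icc 0 a
  · have hle : 0 ≤ b * (1 - x / a) := by
      have := (div_le_one ha).mpr hx.2
      exact mul_nonneg hb.le (by linarith)
    rw [indicator_of_mem hx, intervalIntegral.integral_of_le hle, ← integral_Icc_eq_integral_Ioc,
      ← integral_indicator measurableSet_Icc]
    congr 1
    funext y
    by_cases hy : y ∈ Icc 0 (b * (1 - x / a))
    · rw [indicator_of_mem hy, indicator_of_mem ((hmem y).mpr ⟨hx, hy⟩)]
    · rw [indicator_of_notMem hy, indicator_of_notMem fun h => hy ((hmem y).mp h).2]
  · rw [indicator_of_notMem hx]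
    have h0 : ∀ y, (stdTri a b).indicator f !₂[x, y] = 0 := fun y =>
      indicator_of_notMem (fun h => hx ((hmem y).mp h).1) _
    simp [h0]

lemma measureReal_stdTri {a b : ℝ} (ha : 0 < a) (hb : 0 < b) :
    volume.real (stdTri a b) = a * b / 2 := by
  have h := setIntegral_stdTri ha hb (f := fun _ => 1) continuous_const
  simp only [integral_const, measureReal_restrict_apply_univ, smul_eq_mul, mul_one,
    intervalIntegral.integral_const, sub_zero] at h
  rw [h, intervalIntegral.integral_const_mul, intervalIntegral.integral_sub (by simp)
    (by exact (continuous_id.div_const a).intervalIntegrable _ _)]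
  simp
  field_simp
  ring

lemma setIntegral_interior_stdTri (a b : ℝ) (f : E2 → ℝ) :
    ∫ p in interior (stdTri a b), f p = ∫ p in stdTri a b, f p := by
  refine setIntegral_congr_set ?_
  exact interior_ae_eq_of_null_frontier (convex_stdTri.addHaar_frontier volume)

/-- The first eigenfunction of the isosceles right triangle with legs `l`. -/
def cosSum (l : ℝ) (p : E2) : ℝ := Real.cos (Real.pi / l * p 0) + Real.cos (Real.pi / l * p 1)

lemma contDiff_cosSum (l : ℝ) : ContDiff ℝ (⊤ : ℕ∞) (cosSum l) := by
  unfold cosSum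
  fun_prop

lemma norm_fderiv_cosSum_sq (l : ℝ) (p : E2) : ‖fderiv ℝ (cosSum l) p‖ ^ 2 =
    (Real.pi / l) ^ 2 * (Real.sin (Real.pi / l * p 0) ^ 2 + Real.sin (Real.pi / l * p 1) ^ 2) := by
  have hd : DifferentiableAt ℝ (cosSum l) p := (contDiff_cosSum l).differentiable (by simp) p
  obtain ⟨x, y, rfl⟩ : ∃ x y : ℝ, p = !₂[x, y] :=
    ⟨p 0, p 1, by ext i; fin_cases i <;> simp⟩
  have hcos : ∀ k t : ℝ, HasDerivAt (fun t => Real.cos (k * t)) (-Real.sin (k * t) * k) t := by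
    intro k t
    have h : HasDerivAt (fun t => k * t) k t := by simpa using (hasDerivAt_id t).const_mul k
    exact h.cos
  rw [norm_sq_dual_eq, ← hd.lineDeriv_eq_fderiv, ← hd.lineDeriv_eq_fderiv, lineDeriv_single_zero,
    lineDeriv_single_one]
  have h0 : deriv (fun t => cosSum l !₂[t, y]) x = _ := ((hcos (Real.pi / l) x).add_const
    (Real.cos (Real.pi / l * y))).deriv
  have h1 : deriv (fun t => cosSum l !₂[x, t]) y = _ := ((hcos (Real.pi / l) y).const_add
    (Real.cos (Real.pi / l * x))).deriv
  rw [h0, h1]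
  simp only [Matrix.cons_val_zero, Matrix.cons_val_one]
  ring

lemma integral_norm_fderiv_cosSum_sq {l : ℝ} (hl : 0 < l) :
    ∫ p in stdTri l l, ‖fderiv ℝ (cosSum l) p‖ ^ 2 =
      (Real.pi / l) ^ 2 * ∫ p in stdTri l l, cosSum l p ^ 2 := by
  set k := Real.pi / l with hk
  have hk0 : k ≠ 0 := (div_pos Real.pi_pos hl).ne'
  have hkl : k * l = Real.pi := by rw [hk]; field_simp
  have hT := isCompact_stdTri hl hl
  have hc1 : Continuous fun p : E2 => Real.sin (k * p 0) ^ 2 + Real.sin (k * p 1) ^ 2 := by fun_prop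
  have hc2 : Continuous fun p : E2 => cosSum l p ^ 2 := (contDiff_cosSum l).continuous.pow 2
  have hc3 : Continuous fun p : E2 =>
      Real.sin (k * p 0) ^ 2 + Real.sin (k * p 1) ^ 2 - cosSum l p ^ 2 := hc1.sub hc2
  simp only [norm_fderiv_cosSum_sq, ← hk]
  rw [integral_const_mul]
  congr 1
  rw [← sub_eq_zero, ← integral_sub (hc1.continuousOn.integrableOn_compact hT)
    (hc2.continuousOn.integrableOn_compact hT), setIntegral_stdTri hl hl hc3]
  have hlin : ∀ c t : ℝ, HasDerivAt (fun t => c * t) c t := fun c t => by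
    simpa using (hasDerivAt_id t).const_mul c
  have hin : ∀ x : ℝ, ∫ y in (0 : ℝ)..l * (1 - x / l),
      (Real.sin (k * !₂[x, y] 0) ^ 2 + Real.sin (k * !₂[x, y] 1) ^ 2 - cosSum l !₂[x, y] ^ 2) =
      -(l - x) * Real.cos (2 * k * x) - Real.sin (2 * k * x) / (2 * k) := by
    intro x
    have hend : l * (1 - x / l) = l - x := by field_simp
    rw [hend]
    have hF : ∀ y ∈ uIcc 0 (l - x), HasDerivAt (fun y => -(Real.cos (2 * k * x) * y) -
        Real.sin (2 * k * y) / (2 * k) - 2 * Real.cos (k * x) * (Real.sin (k * y) / k))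
        (Real.sin (k * !₂[x, y] 0) ^ 2 + Real.sin (k * !₂[x, y] 1) ^ 2 - cosSum l !₂[x, y] ^ 2)
        y := by
      intro y _
      have h := (((hlin (Real.cos (2 * k * x)) y).neg).sub
        (((hlin (2 * k) y).sin).div_const (2 * k))).sub
        ((((hlin k y).sin).div_const k).const_mul (2 * Real.cos (k * x)))
      convert! h using 1
      simp only [cosSum, Matrix.cons_val_zero, Matrix.cons_val_one, ← hk]
      rw [mul_div_assoc, div_self (by positivity : 2 * k ≠ 0), mul_div_assoc, div_self hk0,
        mul_assoc 2 k x, mul_assoc 2 k y, Real.cos_two_mul, Real.cos_two_mul, Real.sin_sq,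
        Real.sin_sq]
      ring
    rw [intervalIntegral.integral_eq_sub_of_hasDerivAt hF
      (Continuous.intervalIntegrable (by unfold cosSum; simp; fun_prop) _ _)]
    have e1 : Real.sin (k * (l - x)) = Real.sin (k * x) := by
      rw [mul_sub, hkl, Real.sin_pi_sub]
    have e2 : Real.sin (2 * k * (l - x)) = -Real.sin (2 * k * x) := by
      have : 2 * k * (l - x) = 2 * Real.pi - 2 * k * x := by rw [← hkl]; ring
      rw [this, Real.sin_two_pi_sub]
    simp only [e1, e2, mul_zero, Real.sin_zero, zero_div]
    rw [mul_assoc 2 k x, Real.sin_two_mul]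
    field_simp
    ring
  simp only [hin]
  have hH : ∀ x ∈ uIcc 0 l, HasDerivAt (fun x => -((l - x) * Real.sin (2 * k * x)) / (2 * k) +
      Real.cos (2 * k * x) / (2 * k ^ 2))
      (-(l - x) * Real.cos (2 * k * x) - Real.sin (2 * k * x) / (2 * k)) x := by
    intro x _
    have h := (((((hasDerivAt_id x).const_sub l).mul (hlin (2 * k) x).sin).neg).div_const
      (2 * k)).add (((hlin (2 * k) x).cos).div_const (2 * k ^ 2))
    convert! h using 1
    simp only [id]
    field_simp
    ring
  rw [intervalIntegral.integral_eq_sub_of_hasDerivAt hH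
    (Continuous.intervalIntegrable (by fun_prop) _ _)]
  have e3 : 2 * k * l = 2 * Real.pi := by rw [mul_assoc, hkl]
  simp [e3]

/-- The hypotenuse of the standard triangle. -/
def stdHyp (a b : ℝ) : Set E2 := {p | p ∈ stdTri a b ∧ p 0 / a + p 1 / b = 1}

lemma NotAEZero.integral_sq_pos {a b : ℝ} (ha : 0 < a) (hb : 0 < b) {u : E2 → ℝ}
    (hu : Continuous u) (h : NotAEZero (interior (stdTri a b)) u) :
    0 < ∫ p in interior (stdTri a b), u p ^ 2 := by
  have hi : IntegrableOn (fun p => u p ^ 2) (interior (stdTri a b)) :=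
    ((hu.pow 2).continuousOn.integrableOn_compact (isCompact_stdTri ha hb)).mono_set
      interior_subset
  refine lt_of_le_of_ne (integral_nonneg fun p => sq_nonneg _) fun h0 => h ?_
  have h1 := (integral_eq_zero_iff_of_nonneg (fun p => sq_nonneg (u p)) hi).mp h0.symm
  filter_upwards [h1] with p hp
  simpa using hp

lemma notAEZero_of_ne_zero {a b : ℝ} (ha : 0 < a) (hb : 0 < b) {u : E2 → ℝ}
    (hu : ∀ p : E2, 0 < p 0 → 0 < p 1 → p 0 / a + p 1 / b < 1 → u p ≠ 0) :
    NotAEZero (interior (stdTri a b)) u := by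
  intro h
  let O : Set E2 := {p | 0 < p 0 ∧ 0 < p 1 ∧ p 0 / a + p 1 / b < 1}
  have hO : IsOpen O := by
    have hc : ∀ i : Fin 2, Continuous fun p : E2 => p i := fun i => by fun_prop
    exact (isOpen_lt continuous_const (hc 0)).inter ((isOpen_lt continuous_const (hc 1)).inter
      (isOpen_lt (((hc 0).div_const a).add ((hc 1).div_const b)) continuous_const))
  have hOne : O.Nonempty := by
    refine ⟨!₂[a / 4, b / 4], by simp [ha], by simp [hb], ?_⟩
    have h1 : a / 4 / a = 1 / 4 := by field_simp
    have h2 : b / 4 / b = 1 / 4 := by field_simp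
    simp only [Matrix.cons_val_zero, Matrix.cons_val_one, h1, h2]
    norm_num
  have hsub : O ⊆ interior (stdTri a b) :=
    interior_maximal (fun p hp => ⟨hp.1.le, hp.2.1.le, hp.2.2.le⟩) hO
  have h1 := ae_restrict_of_ae_restrict_of_subset hsub h
  rw [ae_restrict_iff' hO.measurableSet] at h1
  have h2 : ∀ᵐ p : E2, p ∉ O := by
    filter_upwards [h1] with p hp hpO
    exact hu p hpO.1 hpO.2.1 hpO.2.2 (hp hpO)
  exact (hO.measure_pos volume hOne).ne' (measure_eq_zero_iff_ae_notMem.mpr h2)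

lemma firstMixedEig_stdTri_ge {a b : ℝ} (ha : 0 < a) (hb : 0 < b) :
    Real.pi ^ 2 / (a * b) ≤ firstMixedEig (interior (stdTri a b)) (stdHyp a b) := by
  refine le_csInf ?_ ?_
  · refine ⟨_, fun p => 1 - (p 0 / a + p 1 / b), by fun_prop, fun p hp => ?_, ?_, rfl⟩
    · simp only [hp.2, sub_self]
    · exact notAEZero_of_ne_zero ha hb fun p _ _ h => by linarith
  · rintro r ⟨u, hu, hD, hne, rfl⟩
    rw [rayleigh, le_div_iff₀ (hne.integral_sq_pos ha hb hu.continuous)]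
    exact stdTri_energy_ge ha hb hu fun p hp h => hD p ⟨hp, h⟩

lemma firstMixedEig_stdTri_self_le {l : ℝ} (hl : 0 < l) :
    firstMixedEig (interior (stdTri l l)) (stdHyp l l) ≤ Real.pi ^ 2 / (l * l) := by
  have hne : NotAEZero (interior (stdTri l l)) (cosSum l) := by
    refine notAEZero_of_ne_zero hl hl fun p h0 h1 h => ?_
    rw [← add_div, div_lt_one hl] at h
    have hk : 0 < Real.pi / l := div_pos Real.pi_pos hl
    have hkl : Real.pi / l * l = Real.pi := by field_simp
    have hlt : Real.pi / l * p 0 < Real.pi - Real.pi / l * p 1 := by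
      have := mul_lt_mul_of_pos_left h hk
      rw [mul_add, hkl] at this
      linarith
    have h2 := Real.cos_lt_cos_of_nonneg_of_le_pi (by positivity)
      (by have := mul_pos hk h1; linarith) hlt
    rw [Real.cos_pi_sub] at h2
    unfold cosSum
    linarith
  refine csInf_le ⟨0, ?_⟩ ⟨cosSum l, contDiff_cosSum l, ?_, hne, ?_⟩
  · rintro r ⟨u, -, -, -, rfl⟩
    exact div_nonneg (integral_nonneg fun p => sq_nonneg _) (integral_nonneg fun p => sq_nonneg _)
  · rintro p ⟨-, h⟩
    have h1 : Real.pi / l * p 1 = Real.pi - Real.pi / l * p 0 := by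
      rw [← add_div, div_eq_one_iff_eq hl.ne'] at h
      rw [← h]
      have : p 0 + p 1 ≠ 0 := by rw [h]; exact hl.ne'
      field_simp
      ring
    simp [cosSum, h1, Real.cos_pi_sub]
  · have hpos := hne.integral_sq_pos hl hl (contDiff_cosSum l).continuous
    rw [setIntegral_interior_stdTri] at hpos
    rw [rayleigh, setIntegral_interior_stdTri, setIntegral_interior_stdTri,
      integral_norm_fderiv_cosSum_sq hl, mul_div_cancel_right₀ _ hpos.ne']
    ring

/-- The rigid motion `p ↦ A + L p` as a homeomorphism. -/
def rigidMotion (A : E2) (L : E2 ≃ₗᵢ[ℝ] E2) : E2 ≃ₜ E2 := L.toHomeomorph.trans (Homeomorph.addLeft A)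

lemma rigidMotion_apply (A : E2) (L : E2 ≃ₗᵢ[ℝ] E2) (p : E2) : rigidMotion A L p = A + L p := rfl

lemma measurePreserving_rigidMotion (A : E2) (L : E2 ≃ₗᵢ[ℝ] E2) :
    MeasurePreserving (rigidMotion A L) volume volume :=
  (measurePreserving_add_left volume A).comp L.measurePreserving

lemma rayleigh_image_rigidMotion (A : E2) (L : E2 ≃ₗᵢ[ℝ] E2) (Ω : Set E2) (u : E2 → ℝ) :
    rayleigh (rigidMotion A L '' Ω) u = rayleigh Ω (u ∘ rigidMotion A L) := by
  have hm := measurePreserving_rigidMotion A L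
  have he := (rigidMotion A L).measurableEmbedding
  have h : ∀ p, ‖fderiv ℝ (u ∘ rigidMotion A L) p‖ = ‖fderiv ℝ u (rigidMotion A L p)‖ :=
    fun p => norm_fderiv_comp_isometry u A L p
  simp only [rayleigh, hm.setIntegral_image_emb he, h, Function.comp_apply]

lemma notAEZero_image_rigidMotion (A : E2) (L : E2 ≃ₗᵢ[ℝ] E2) (Ω : Set E2) (u : E2 → ℝ) :
    NotAEZero (rigidMotion A L '' Ω) u ↔ NotAEZero Ω (u ∘ rigidMotion A L) := by
  have he := (rigidMotion A L).measurableEmbedding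
  have hm := (measurePreserving_rigidMotion A L).restrict_image_emb he Ω
  rw [NotAEZero, NotAEZero, ← hm.map_eq, he.ae_map_iff]
  rfl

lemma contDiff_rigidMotion (A : E2) (L : E2 ≃ₗᵢ[ℝ] E2) :
    ContDiff ℝ (⊤ : ℕ∞) (rigidMotion A L) :=
  contDiff_const.add L.contDiff

lemma contDiff_rigidMotion_symm (A : E2) (L : E2 ≃ₗᵢ[ℝ] E2) :
    ContDiff ℝ (⊤ : ℕ∞) (rigidMotion A L).symm :=
  L.symm.contDiff.comp (contDiff_const.add contDiff_id)

lemma firstMixedEig_image_rigidMotion (A : E2) (L : E2 ≃ₗᵢ[ℝ] E2) (Ω D : Set E2) :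
    firstMixedEig (rigidMotion A L '' Ω) (rigidMotion A L '' D) = firstMixedEig Ω D := by
  unfold firstMixedEig
  congr 1
  ext r
  constructor
  · rintro ⟨u, hu, hD, hne, rfl⟩
    exact ⟨u ∘ rigidMotion A L, hu.comp (contDiff_rigidMotion A L),
      fun x hx => hD _ (mem_image_of_mem _ hx), (notAEZero_image_rigidMotion A L Ω u).mp hne,
      rayleigh_image_rigidMotion A L Ω u⟩
  · rintro ⟨v, hv, hD, hne, rfl⟩
    have hcomp : (v ∘ (rigidMotion A L).symm) ∘ rigidMotion A L = v := by
      funext p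
      simp
    refine ⟨v ∘ (rigidMotion A L).symm, hv.comp (contDiff_rigidMotion_symm A L), ?_, ?_, ?_⟩
    · rintro _ ⟨x, hx, rfl⟩
      simpa using hD x hx
    · rw [notAEZero_image_rigidMotion, hcomp]
      exact hne
    · rw [rayleigh_image_rigidMotion, hcomp]

lemma segment_eq_stdHyp {a b : ℝ} (ha : 0 < a) (hb : 0 < b) :
    segment ℝ (!₂[a, 0] : E2) !₂[0, b] = stdHyp a b := by
  ext p
  constructor
  · rintro ⟨s, t, hs, ht, hst, rfl⟩
    have h : (s * a) / a + (t * b) / b = 1 := by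
      rw [mul_div_cancel_right₀ _ ha.ne', mul_div_cancel_right₀ _ hb.ne', hst]
    refine ⟨⟨?_, ?_, ?_⟩, ?_⟩
    · simp; positivity
    · simp; positivity
    · simpa using h.le
    · simpa using h
  · rintro ⟨⟨h1, h2, -⟩, h3⟩
    refine ⟨p 0 / a, p 1 / b, by positivity, by positivity, h3, ?_⟩
    ext i
    fin_cases i <;> simp [ha.ne', hb.ne']

/-- A right triangle is the image of a standard one under a rigid motion. -/
lemma exists_rigidMotion_of_right_triangle {A B C : E2}
    (hT : ¬ Collinear ℝ ({A, B, C} : Set E2)) (hright : ∠ B A C = Real.pi / 2) :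
    0 < dist A B ∧ 0 < dist A C ∧ ∃ L : E2 ≃ₗᵢ[ℝ] E2,
      convexHull ℝ ({A, B, C} : Set E2) = rigidMotion A L '' stdTri (dist A B) (dist A C) ∧
      segment ℝ B C = rigidMotion A L '' stdHyp (dist A B) (dist A C) := by
  have ha : 0 < dist A B := by
    refine dist_pos.mpr fun h => hT ?_
    rw [h, insert_eq_of_mem (mem_insert _ _)]
    exact collinear_pair ℝ B C
  have hb : 0 < dist A C := by
    refine dist_pos.mpr fun h => hT ?_
    rw [h, pair_comm, insert_eq_of_mem (mem_insert _ _)]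
    exact collinear_pair ℝ C B
  refine ⟨ha, hb, ?_⟩
  set a := dist A B
  set b := dist A C
  have hna : ‖B - A‖ = a := by rw [← dist_eq_norm, dist_comm]
  have hnb : ‖C - A‖ = b := by rw [← dist_eq_norm, dist_comm]
  have hin : inner ℝ (B - A) (C - A) = 0 :=
    InnerProductGeometry.inner_eq_zero_iff_angle_eq_pi_div_two _ _ |>.mpr hright
  obtain ⟨L, hL⟩ := exists_linearIsometryEquiv_of_orthonormal (a⁻¹ • (B - A)) (b⁻¹ • (C - A))
    (by rw [norm_smul, hna, norm_inv, Real.norm_of_nonneg ha.le, inv_mul_cancel₀ ha.ne'])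
    (by rw [norm_smul, hnb, norm_inv, Real.norm_of_nonneg hb.le, inv_mul_cancel₀ hb.ne'])
    (by rw [inner_smul_left, inner_smul_right, hin]; simp)
  let Φ : E2 →ᵃ[ℝ] E2 := L.toLinearEquiv.toLinearMap.toAffineMap + AffineMap.const ℝ E2 A
  have hΦ : ⇑Φ = rigidMotion A L := by
    funext p
    simp [Φ, rigidMotion_apply, add_comm]
  have h0 : rigidMotion A L 0 = A := by simp [rigidMotion_apply]
  have h1 : rigidMotion A L !₂[a, 0] = B := by
    rw [rigidMotion_apply, hL]
    simp [smul_smul, ha.ne']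
  have h2 : rigidMotion A L !₂[0, b] = C := by
    rw [rigidMotion_apply, hL]
    simp [smul_smul, hb.ne']
  refine ⟨L, ?_, ?_⟩
  · rw [← convexHull_eq_stdTri ha hb, ← hΦ, AffineMap.image_convexHull, image_insert_eq,
      image_pair, hΦ, h0, h1, h2]
  · rw [← segment_eq_stdHyp ha hb, ← hΦ, image_segment, hΦ, h1, h2]

lemma measureReal_image_rigidMotion (A : E2) (L : E2 ≃ₗᵢ[ℝ] E2) (s : Set E2) :
    volume.real (rigidMotion A L '' s) = volume.real s := by
  have h := (measurePreserving_rigidMotion A L).measure_preimage_emb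
    (rigidMotion A L).measurableEmbedding (rigidMotion A L '' s)
  rw [preimage_image_eq _ (rigidMotion A L).injective] at h
  rw [measureReal_def, measureReal_def, h]

/-- For a right triangle `T_R = △ABC` (right angle at `A`, hypotenuse `BC`) and
an isosceles right triangle `T_R* = △A'B'C'` (right angle at `A'`, `|A'B'| = |A'C'|`,
hypotenuse `B'C'`) of the same area, the first mixed eigenvalues with Dirichlet condition on
the hypotenuse and Neumann condition on the legs satisfy `λ₁^L(T_R) ≥ λ₁^L(T_R*)`. -/
theorem stmt_3 (A B C A' B' C' : E2)
    (hT : ¬ Collinear ℝ ({A, B, C} : Set E2))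
    (hT' : ¬ Collinear ℝ ({A', B', C'} : Set E2))
    (hright : ∠ B A C = Real.pi / 2)
    (hright' : ∠ B' A' C' = Real.pi / 2)
    (hlegs' : dist A' B' = dist A' C')
    (harea : volume (convexHull ℝ ({A, B, C} : Set E2)) =
      volume (convexHull ℝ ({A', B', C'} : Set E2))) :
    firstMixedEig (triangleO A B C) (segment ℝ B C) ≥
      firstMixedEig (triangleO A' B' C') (segment ℝ B' C') := by
  obtain ⟨ha, hb, L, hhull, hseg⟩ := exists_rigidMotion_of_right_triangle hT hright
  obtain ⟨hl, -, L', hhull', hseg'⟩ := exists_rigidMotion_of_right_triangle hT' hright'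
  rw [← hlegs'] at hhull' hseg'
  have hab : dist A B * dist A C = dist A' B' * dist A' B' := by
    have h := congrArg ENNReal.toReal harea
    rw [← measureReal_def, ← measureReal_def, hhull, hhull', measureReal_image_rigidMotion,
      measureReal_image_rigidMotion, measureReal_stdTri ha hb, measureReal_stdTri hl hl] at h
    linarith
  rw [triangleO, triangleO, hhull, hhull', hseg, hseg', ← Homeomorph.image_interior,
    ← Homeomorph.image_interior, firstMixedEig_image_rigidMotion, firstMixedEig_image_rigidMotion]
  refine (firstMixedEig_stdTri_self_le hl).trans ?_
  rw [← hab]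
  exact firstMixedEig_stdTri_ge ha hb

end
end

section
/- Let T be a nondegenerate triangle in ℝ² with longest side L, and let Q be the (open) quadrilateral obtained as the interior of the union of the closure of T and its reflection across the line containing L. Then λ₁^{MS}(T) ≥ λ₁(Q), where λ₁(Q) is the first Dirichlet eigenvalue of the Laplacian on Q. -/
open MeasureTheory Set EuclideanGeometry

noncomputable section

open Filter Topology

/-- An affine isometry fixing two of three affinely independent points of the plane moves points
parallel to a fixed direction, by an amount proportional to the barycentric coordinate of the third
point. -/
lemma isometry_apply_eq_sub (b : AffineBasis (Fin 3) ℝ E2) (σ : E2 ≃ᵃⁱ[ℝ] E2)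
    (h1 : σ (b 1) = b 1) (h2 : σ (b 2) = b 2) (x : E2) :
    σ x = x - (2 * b.coord 0 x) • ((1 / 2 : ℝ) • (b 0 - σ (b 0))) := by
  have key : (σ.toAffineEquiv : E2 →ᵃ[ℝ] E2) = AffineMap.id ℝ E2 -
      (LinearMap.toSpanSingleton ℝ E2 (b 0 - σ (b 0))).toAffineMap.comp (b.coord 0) := by
    refine AffineMap.ext_on b.tot ?_
    rintro _ ⟨i, rfl⟩
    fin_cases i <;> simp [h1, h2]
  have := congrArg (fun f : E2 →ᵃ[ℝ] E2 => f x) key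
  rw [smul_smul, show 2 * b.coord 0 x * (1 / 2) = b.coord 0 x by ring]
  simpa using this

lemma coord_isometry_apply_vertex (b : AffineBasis (Fin 3) ℝ E2) (σ : E2 ≃ᵃⁱ[ℝ] E2)
    (h1 : σ (b 1) = b 1) (h2 : σ (b 2) = b 2) (hσ : σ ≠ AffineIsometryEquiv.refl ℝ E2) :
    b.coord 0 (σ (b 0)) = -1 := by
  set a := b.coord 0 (σ (b 0)) with ha
  set q := b.coord 2 (σ (b 0)) with hq
  have hsum := b.linear_combination_coord_eq_self (σ (b 0))
  have hone := b.sum_coord_apply_eq_one (σ (b 0))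
  rw [Fin.sum_univ_three] at hsum hone
  rw [← ha, ← hq] at hsum hone
  have hp : b.coord 1 (σ (b 0)) = 1 - a - q := by linarith
  rw [hp] at hsum
  set w := b 0 - b 1 with hw
  set e := b 2 - b 1 with he
  have hB : σ (b 0) - b 1 = a • w + q • e := by
    rw [← hsum, hw, he]; module
  have hC : σ (b 0) - b 2 = (a • w + q • e) - e := by
    rw [← hsum, hw, he]; module
  have dB : ‖a • w + q • e‖ = ‖w‖ := by
    rw [← hB, ← dist_eq_norm, hw, ← dist_eq_norm]
    conv_lhs => rw [← h1]
    exact σ.dist_map _ _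
  have dC : ‖(a • w + q • e) - e‖ = ‖w - e‖ := by
    rw [← hC, ← dist_eq_norm, hw, he, sub_sub_sub_cancel_right, ← dist_eq_norm]
    conv_lhs => rw [← h2]
    exact σ.dist_map _ _
  have dB2 := congrArg (· ^ 2) dB
  have dC2 := congrArg (· ^ 2) dC
  simp only [norm_sub_sq_real, dB] at dC2
  simp only [norm_add_sq_real, inner_smul_left, inner_smul_right, inner_add_left, norm_smul,
    mul_pow, Real.norm_eq_abs, sq_abs, real_inner_self_eq_norm_sq, conj_trivial] at dB2 dC2
  set W := ‖w‖ ^ 2 with hW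
  set E := ‖e‖ ^ 2 with hE
  set P := inner ℝ w e with hP
  have hqE : a * P + q * E = P := by linarith
  have hlin : ∀ s t : ℝ, s • w = t • e → s = 0 := by
    intro s t hst
    have h := congrArg (b.coord 0).linear hst
    have hlw : (b.coord 0).linear w = 1 := by
      rw [hw, ← vsub_eq_sub, AffineMap.linearMap_vsub]; simp
    have hle : (b.coord 0).linear e = 0 := by
      rw [he, ← vsub_eq_sub, AffineMap.linearMap_vsub]; simp
    rw [map_smul, map_smul, hlw, hle] at h
    simpa using h
  have hE0 : 0 < E := by
    refine lt_of_le_of_ne (sq_nonneg _) fun h => ?_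
    have : e = 0 := by simpa [hE] using h.symm
    have : b 2 = b 1 := sub_eq_zero.1 this
    exact absurd (b.ind.injective this) (by decide)
  have hCS : W * E - P ^ 2 ≠ 0 := by
    intro h
    refine hE0.ne' (hlin E P ?_)
    rw [← sub_eq_zero, ← norm_eq_zero, ← sq_eq_zero_iff, norm_sub_sq_real]
    simp only [inner_smul_left, inner_smul_right, norm_smul,
      mul_pow, Real.norm_eq_abs, sq_abs, conj_trivial, ← hW, ← hE, ← hP]
    linear_combination E * h
  have hfac : (a - 1) * ((a + 1) * (W * E - P ^ 2)) = 0 := by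
    linear_combination E * dB2 - (a * P + q * E + P) * hqE
  rcases mul_eq_zero.1 hfac with h | h
  · exfalso
    have ha1 : a = 1 := by linarith
    have hq0 : q = 0 := by
      rw [ha1] at hqE
      have : q * E = 0 := by linarith
      exact (mul_eq_zero.1 this).resolve_right hE0.ne'
    have hA : σ (b 0) = b 0 := by
      rw [← hsum, ha1, hq0]; simp
    refine hσ (AffineIsometryEquiv.ext fun x => ?_)
    rw [isometry_apply_eq_sub b σ h1 h2 x, hA]; simp
  · have := (mul_eq_zero.1 h).resolve_right hCS
    linarith

/-- The map that moves `x` along `m` so that its coordinate `α x` becomes `√(α x ^ 2 + ε ^ 2)`.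
For `ε = 0` this folds the half-plane `α ≤ 0` onto `0 ≤ α`. -/
def foldMap (α : E2 → ℝ) (m : E2) (ε : ℝ) (x : E2) : E2 :=
  x + (√(α x ^ 2 + ε ^ 2) - α x) • m

lemma continuous_foldMap {α : E2 → ℝ} (hα : Continuous α) (m : E2) :
    Continuous fun p : ℝ × E2 => foldMap α m p.1 p.2 := by
  unfold foldMap; fun_prop

lemma foldMap_zero (α : E2 → ℝ) (m x : E2) : foldMap α m 0 x = x + (|α x| - α x) • m := by
  simp [foldMap, Real.sqrt_sq_eq_abs]

lemma dist_foldMap_le (α : E2 → ℝ) (m : E2) (ε : ℝ) (x : E2) :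
    dist (foldMap α m ε x) (foldMap α m 0 x) ≤ |ε| * ‖m‖ := by
  rw [foldMap_zero, foldMap, dist_add_left, dist_eq_norm, ← sub_smul, norm_smul]
  refine mul_le_mul_of_nonneg_right ?_ (norm_nonneg _)
  have h1 : |α x| ≤ √(α x ^ 2 + ε ^ 2) := Real.abs_le_sqrt (by nlinarith [sq_nonneg ε])
  have h2 : √(α x ^ 2 + ε ^ 2) ≤ |α x| + |ε| := by
    refine Real.sqrt_le_iff.2 ⟨by positivity, ?_⟩
    nlinarith [sq_abs (α x), sq_abs ε, abs_nonneg (α x), abs_nonneg ε,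
      mul_nonneg (abs_nonneg (α x)) (abs_nonneg ε)]
  rw [Real.norm_eq_abs, sub_sub_sub_cancel_right, abs_of_nonneg (by linarith)]
  linarith

lemma contDiff_foldMap {α : E2 → ℝ} (hα : ContDiff ℝ (⊤ : ℕ∞) α) (m : E2) {ε : ℝ} (hε : ε ≠ 0) :
    ContDiff ℝ (⊤ : ℕ∞) (foldMap α m ε) := by
  unfold foldMap
  refine contDiff_id.add (ContDiff.smul (ContDiff.sub (ContDiff.sqrt ?_ ?_) hα) contDiff_const)
  · fun_prop
  · intro x; positivity

/-- If the linear reflection `v ↦ v - 2 ℓ v • m` is an isometry, then smoothed folding maps are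
nonexpanding to first order. -/
lemma norm_fderiv_foldMap_le {α : E2 → ℝ} {ℓ : E2 →L[ℝ] ℝ} (hα : ∀ x, HasFDerivAt α ℓ x) {m : E2}
    (hm : ∀ v, ‖v - (2 * ℓ v) • m‖ = ‖v‖) {ε : ℝ} (hε : ε ≠ 0) (x : E2) :
    ‖fderiv ℝ (foldMap α m ε) x‖ ≤ 1 := by
  set r := √(α x ^ 2 + ε ^ 2) with hr
  have hr0 : 0 < r := Real.sqrt_pos.2 (by positivity)
  have hsq : HasFDerivAt (fun y => α y ^ 2 + ε ^ 2) ((2 * α x) • ℓ) x := by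
    simpa using ((hα x).pow 2).add_const (ε ^ 2)
  have hd : HasFDerivAt (foldMap α m ε)
      (ContinuousLinearMap.id ℝ E2 +
        ((1 / (2 * r)) • ((2 * α x) • ℓ) - ℓ).smulRight m) x :=
    (hasFDerivAt_id x).add
      (((hsq.sqrt (by positivity)).sub (hα x)).smul_const m)
  rw [hd.fderiv]
  refine ContinuousLinearMap.opNorm_le_bound _ zero_le_one fun v => ?_
  set s := α x / r with hs
  have hs1 : |s| ≤ 1 := by
    rw [hs, abs_div, abs_of_pos hr0, div_le_one hr0]
    exact Real.abs_le_sqrt (by nlinarith [sq_nonneg ε])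
  obtain ⟨hsl, hsu⟩ := abs_le.1 hs1
  have hval : (ContinuousLinearMap.id ℝ E2 +
        ((1 / (2 * r)) • ((2 * α x) • ℓ) - ℓ).smulRight m) v =
      ((1 + s) / 2) • v + ((1 - s) / 2) • (v - (2 * ℓ v) • m) := by
    have : 1 / (2 * r) * (2 * α x * ℓ v) = s * ℓ v := by rw [hs]; field_simp
    simp only [add_apply, ContinuousLinearMap.id_apply,
      ContinuousLinearMap.smulRight_apply, sub_apply,
      smul_apply, smul_eq_mul, this]
    module
  rw [hval]
  refine (norm_add_le _ _).trans ?_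
  rw [norm_smul, norm_smul, hm, Real.norm_of_nonneg (by linarith), Real.norm_of_nonneg (by linarith)]
  linarith

lemma foldMap_zero_of_nonneg {α : E2 → ℝ} {x : E2} (hx : 0 ≤ α x) (m : E2) :
    foldMap α m 0 x = x := by
  simp [foldMap_zero, abs_of_nonneg hx]

lemma foldMap_zero_of_nonpos {α : E2 → ℝ} {x : E2} (hx : α x ≤ 0) (m : E2) :
    foldMap α m 0 x = x - (2 * α x) • m := by
  rw [foldMap_zero, abs_of_nonpos hx]; module

lemma mem_segment_of_coord_eq_zero (b : AffineBasis (Fin 3) ℝ E2) {i j k : Fin 3}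
    (hij : i ≠ j) (hik : i ≠ k) (hjk : j ≠ k) {y : E2}
    (hy : ∀ l, 0 ≤ b.coord l y) (h0 : b.coord i y = 0) : y ∈ segment ℝ (b j) (b k) := by
  have huniv : (Finset.univ : Finset (Fin 3)) = {i, j, k} := by
    clear h0
    revert i j k
    decide
  have hsum := b.linear_combination_coord_eq_self y
  have hone := b.sum_coord_apply_eq_one y
  rw [huniv, Finset.sum_insert (by simp [hij, hik]), Finset.sum_pair hjk, h0] at hsum hone
  exact ⟨b.coord j y, b.coord k y, hy j, hy k, by simpa using hone, by simpa using hsum⟩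

lemma measurePreserving_affineIsometryEquiv (σ : E2 ≃ᵃⁱ[ℝ] E2) :
    MeasurePreserving σ (volume : Measure E2) volume := by
  have h : (σ : E2 → E2) = (fun y => y + σ 0) ∘ σ.linearIsometryEquiv := by
    funext x
    have := σ.map_vadd 0 x
    simpa using this
  rw [h]
  exact (measurePreserving_add_right volume (σ 0)).comp σ.linearIsometryEquiv.measurePreserving

/-- A nonidentity affine isometry fixing the vertices `b 1` and `b 2` of a triangle,
in barycentric coordinates. -/
structure IsReflection (b : AffineBasis (Fin 3) ℝ E2) (σ : E2 ≃ᵃⁱ[ℝ] E2) (m : E2) : Prop where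
  apply_eq : ∀ x, σ x = x - (2 * b.coord 0 x) • m
  coord_apply : ∀ x, b.coord 0 (σ x) = -b.coord 0 x

namespace IsReflection

variable {b : AffineBasis (Fin 3) ℝ E2} {σ : E2 ≃ᵃⁱ[ℝ] E2} {m : E2}

lemma of_fixes (h1 : σ (b 1) = b 1) (h2 : σ (b 2) = b 2)
    (hσ : σ ≠ AffineIsometryEquiv.refl ℝ E2) :
    IsReflection b σ ((1 / 2 : ℝ) • (b 0 - σ (b 0))) := by
  refine ⟨isometry_apply_eq_sub b σ h1 h2, fun x => ?_⟩
  have hm : (b.coord 0).linear ((1 / 2 : ℝ) • (b 0 - σ (b 0))) = 1 := by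
    rw [map_smul, ← vsub_eq_sub, AffineMap.linearMap_vsub,
      coord_isometry_apply_vertex b σ h1 h2 hσ]
    simp; norm_num
  rw [isometry_apply_eq_sub b σ h1 h2 x, sub_eq_neg_add, ← vadd_eq_add, AffineMap.map_vadd,
    map_neg, map_smul, hm]
  simp; ring

lemma involutive (h : IsReflection b σ m) (x : E2) : σ (σ x) = x := by
  rw [h.apply_eq (σ x), h.coord_apply, h.apply_eq]; module

lemma norm_sub_smul (h : IsReflection b σ m) (v : E2) :
    ‖v - (2 * (b.coord 0).linear v) • m‖ = ‖v‖ := by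
  have e : v - (2 * (b.coord 0).linear v) • m = σ v - σ 0 := by
    have : (b.coord 0).linear v = b.coord 0 v - b.coord 0 0 := by
      rw [← vsub_eq_sub, ← AffineMap.linearMap_vsub]; simp
    rw [h.apply_eq, h.apply_eq, this]; module
  rw [e, ← dist_eq_norm, σ.dist_map, dist_zero_right]

lemma foldMap_of_nonpos (h : IsReflection b σ m) {x : E2} (hx : b.coord 0 x ≤ 0) :
    foldMap (b.coord 0) m 0 x = σ x := by
  rw [foldMap_zero_of_nonpos hx, h.apply_eq]

lemma coord_foldMap (h : IsReflection b σ m) (x : E2) :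
    b.coord 0 (foldMap (b.coord 0) m 0 x) = |b.coord 0 x| := by
  rcases le_total 0 (b.coord 0 x) with hx | hx
  · rw [foldMap_zero_of_nonneg hx, abs_of_nonneg hx]
  · rw [h.foldMap_of_nonpos hx, h.coord_apply, abs_of_nonpos hx]

lemma foldMap_mem_iff (h : IsReflection b σ m) (x : E2) :
    foldMap (b.coord 0) m 0 x ∈ convexHull ℝ (range b) ↔
      x ∈ convexHull ℝ (range b) ∪ σ '' convexHull ℝ (range b) := by
  rw [b.convexHull_eq_nonneg_coord]
  constructor
  · intro hx
    rcases le_total 0 (b.coord 0 x) with h0 | h0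
    · rw [foldMap_zero_of_nonneg h0] at hx
      exact Or.inl hx
    · rw [h.foldMap_of_nonpos h0] at hx
      exact Or.inr ⟨σ x, hx, h.involutive x⟩
  · rintro (hx | ⟨z, hz, rfl⟩)
    · rwa [foldMap_zero_of_nonneg (hx 0)]
    · rwa [h.foldMap_of_nonpos (by rw [h.coord_apply]; exact neg_nonpos.2 (hz 0)), h.involutive]

lemma foldMap_mem_of_mem_frontier (h : IsReflection b σ m) {x : E2}
    (hx : x ∈ frontier (interior (convexHull ℝ (range b) ∪ σ '' convexHull ℝ (range b)))) :
    foldMap (b.coord 0) m 0 x ∈ segment ℝ (b 0) (b 2) ∪ segment ℝ (b 0) (b 1) := by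
  set K := convexHull ℝ (range b) with hK
  have hKc : IsCompact K := (finite_range b).isCompact_convexHull ℝ
  have hcl : IsClosed (K ∪ σ '' K) :=
    hKc.isClosed.union (hKc.image σ.continuous).isClosed
  rw [isOpen_interior.frontier_eq] at hx
  have hmem : foldMap (b.coord 0) m 0 x ∈ K :=
    (h.foldMap_mem_iff x).2 (hcl.closure_subset_iff.2 interior_subset hx.1)
  rw [hK, b.convexHull_eq_nonneg_coord] at hmem
  have hcont : Continuous (foldMap (b.coord 0) m 0) :=
    (continuous_foldMap (continuous_barycentric_coord b 0) m).comp (Continuous.prodMk_right 0)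
  set U : Set E2 := {y | 0 < b.coord 1 (foldMap (b.coord 0) m 0 y)} ∩
    {y | 0 < b.coord 2 (foldMap (b.coord 0) m 0 y)} with hU
  have hUo : IsOpen U :=
    (isOpen_lt continuous_const ((continuous_barycentric_coord b 1).comp hcont)).inter
      (isOpen_lt continuous_const ((continuous_barycentric_coord b 2).comp hcont))
  have hUs : U ⊆ K ∪ σ '' K := by
    rintro y ⟨h1, h2⟩
    rw [← h.foldMap_mem_iff, b.convexHull_eq_nonneg_coord]
    intro i
    fin_cases i
    · simp [h.coord_foldMap]
    · exact h1.le
    · exact h2.le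
  have hxU : x ∉ U := fun hxU => hx.2 (interior_maximal hUs hUo hxU)
  rcases (hmem 1).eq_or_lt with h1 | h1
  · exact Or.inl (mem_segment_of_coord_eq_zero b (i := 1) (by decide) (by decide) (by decide)
      hmem h1.symm)
  · rcases (hmem 2).eq_or_lt with h2 | h2
    · exact Or.inr (mem_segment_of_coord_eq_zero b (i := 2) (by decide) (by decide) (by decide)
        hmem h2.symm)
    · exact absurd ⟨h1, h2⟩ hxU

lemma union_ae_eq (b : AffineBasis (Fin 3) ℝ E2) (σ : E2 ≃ᵃⁱ[ℝ] E2) :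
    (interior (convexHull ℝ (range b)) ∪ σ '' interior (convexHull ℝ (range b)) : Set E2)
      =ᵐ[volume] (convexHull ℝ (range b) ∪ σ '' convexHull ℝ (range b) : Set E2) := by
  have hc : Convex ℝ (convexHull ℝ (range b)) := convex_convexHull ℝ _
  have hc' : Convex ℝ (σ '' convexHull ℝ (range b)) :=
    hc.affine_image (σ.toAffineEquiv : E2 →ᵃ[ℝ] E2)
  have himg : σ '' interior (convexHull ℝ (range b)) = interior (σ '' convexHull ℝ (range b)) :=
    σ.toHomeomorph.image_interior _
  rw [himg]
  exact (interior_ae_eq_of_null_frontier (hc.addHaar_frontier volume)).union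
    (interior_ae_eq_of_null_frontier (hc'.addHaar_frontier volume))

lemma interior_union_ae_eq (b : AffineBasis (Fin 3) ℝ E2) (σ : E2 ≃ᵃⁱ[ℝ] E2) :
    (interior (convexHull ℝ (range b) ∪ σ '' convexHull ℝ (range b)) : Set E2)
      =ᵐ[volume] (convexHull ℝ (range b) ∪ σ '' convexHull ℝ (range b) : Set E2) := by
  have himg : σ '' interior (convexHull ℝ (range b)) = interior (σ '' convexHull ℝ (range b)) :=
    σ.toHomeomorph.image_interior _
  refine interior_subset.eventuallyLE.antisymm ((union_ae_eq b σ).symm.le.trans ?_)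
  rw [himg]
  exact LE.le.eventuallyLE <| union_subset (interior_mono subset_union_left) (interior_mono subset_union_right)

lemma setIntegral_comp_foldMap (h : IsReflection b σ m) {g : E2 → ℝ} (hg : Continuous g) :
    ∫ x in convexHull ℝ (range b) ∪ σ '' convexHull ℝ (range b),
        g (foldMap (b.coord 0) m 0 x) =
      2 * ∫ x in interior (convexHull ℝ (range b)), g x := by
  set K := convexHull ℝ (range b) with hK
  have hKc : IsCompact K := (finite_range b).isCompact_convexHull ℝ
  have hcont : Continuous (foldMap (b.coord 0) m 0) :=
    (continuous_foldMap (continuous_barycentric_coord b 0) m).comp (Continuous.prodMk_right 0)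
  have hint : interior K = {x | ∀ i, 0 < b.coord i x} := b.interior_convexHull
  have hemb : MeasurableEmbedding σ := σ.toHomeomorph.measurableEmbedding
  have hmeas : MeasurableSet (σ '' interior K) :=
    hemb.measurableSet_image.2 measurableSet_interior
  have hdisj : Disjoint (interior K) (σ '' interior K) := by
    rw [Set.disjoint_left, hint]
    rintro _ hx ⟨z, hz, rfl⟩
    have h1 := hx 0
    have h2 := hz 0
    rw [h.coord_apply] at h1
    linarith
  have hion : ∀ s ⊆ K ∪ σ '' K, IntegrableOn (fun x => g (foldMap (b.coord 0) m 0 x)) s :=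
    fun s hs => ((hg.comp hcont).continuousOn.integrableOn_compact
      (hKc.union (hKc.image σ.continuous))).mono_set hs
  rw [← setIntegral_congr_set (union_ae_eq b σ), setIntegral_union hdisj hmeas
    (hion _ (interior_subset.trans subset_union_left))
    (hion _ ((image_mono interior_subset).trans subset_union_right)),
    (measurePreserving_affineIsometryEquiv σ).setIntegral_image_emb hemb, two_mul]
  rw [hint]
  congr 1
  · refine setIntegral_congr_fun (hint ▸ measurableSet_interior) fun x hx => ?_
    simp only [foldMap_zero_of_nonneg (hx 0).le]
  · refine setIntegral_congr_fun (hint ▸ measurableSet_interior) fun x hx => ?_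
    have : b.coord 0 (σ x) ≤ 0 := by rw [h.coord_apply]; exact neg_nonpos.2 (hx 0).le
    simp only [h.foldMap_of_nonpos this, h.involutive]

end IsReflection

/-- A smooth function that vanishes near `0` and has slope `1` at distance `2 * δ` from `0`. -/
def softThreshold (δ t : ℝ) : ℝ := ∫ s in (0 : ℝ)..t, Real.smoothTransition ((s / δ) ^ 2 - 1)

namespace softThreshold

lemma continuous_integrand (δ : ℝ) :
    Continuous fun s : ℝ => Real.smoothTransition ((s / δ) ^ 2 - 1) :=
  Real.smoothTransition.continuous.comp (by fun_prop)

lemma hasDerivAt (δ t : ℝ) :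
    HasDerivAt (softThreshold δ) (Real.smoothTransition ((t / δ) ^ 2 - 1)) t :=
  intervalIntegral.integral_hasDerivAt_right ((continuous_integrand δ).intervalIntegrable _ _)
    ((continuous_integrand δ).stronglyMeasurableAtFilter _ _) (continuous_integrand δ).continuousAt

lemma contDiff (δ : ℝ) : ContDiff ℝ (⊤ : ℕ∞) (softThreshold δ) := by
  refine contDiff_infty_iff_deriv.2 ⟨fun t => (hasDerivAt δ t).differentiableAt, ?_⟩
  rw [show deriv (softThreshold δ) = _ from funext fun t => (hasDerivAt δ t).deriv]
  exact Real.smoothTransition.contDiff.comp (by fun_prop)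

lemma eq_zero {δ t : ℝ} (ht : |t| ≤ δ) : softThreshold δ t = 0 := by
  rcases (abs_nonneg t).trans ht |>.eq_or_lt with h | hδ
  · have : t = 0 := by simpa [← h] using ht
    simp [softThreshold, this]
  · refine intervalIntegral.integral_zero_ae (Eventually.of_forall fun s hs => ?_)
    refine Real.smoothTransition.zero_of_nonpos ?_
    have hs' : |s| ≤ |t| := by
      have := abs_sub_left_of_mem_uIcc (uIoc_subset_uIcc hs)
      simpa using this
    rw [sub_nonpos, sq_le_one_iff_abs_le_one, abs_div, abs_of_pos hδ, div_le_one hδ]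
    exact hs'.trans ht

lemma abs_le (δ t : ℝ) : |softThreshold δ t| ≤ |t| := by
  have := intervalIntegral.norm_integral_le_of_norm_le_const (a := 0) (b := t) (C := 1)
    (f := fun s => Real.smoothTransition ((s / δ) ^ 2 - 1)) fun s _ => by
      rw [Real.norm_of_nonneg (Real.smoothTransition.nonneg _)]
      exact Real.smoothTransition.le_one _
  simpa [softThreshold] using this

lemma tendsto (t : ℝ) : Tendsto (fun δ => softThreshold δ t) (𝓝[>] 0) (𝓝 t) := by
  have h : Tendsto (fun δ => softThreshold δ t) (𝓝[>] 0) (𝓝 (∫ _ in (0 : ℝ)..t, (1 : ℝ))) := by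
    refine intervalIntegral.tendsto_integral_filter_of_dominated_convergence (fun _ => 1)
      (Eventually.of_forall fun δ => (continuous_integrand δ).aestronglyMeasurable)
      (Eventually.of_forall fun δ => Eventually.of_forall fun s _ => ?_)
      intervalIntegrable_const ?_
    · rw [Real.norm_of_nonneg (Real.smoothTransition.nonneg _)]
      exact Real.smoothTransition.le_one _
    · filter_upwards [compl_mem_ae_iff.2 (measure_singleton (0 : ℝ))] with s hs _
      have hs0 : 0 < |s| := abs_pos.2 hs
      refine tendsto_const_nhds.congr' ?_
      filter_upwards [Ioo_mem_nhdsGT (half_pos hs0)] with δ hδ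
      refine (Real.smoothTransition.one_of_one_le ?_).symm
      have : 2 ≤ |s / δ| := by
        rw [abs_div, abs_of_pos hδ.1, le_div_iff₀ hδ.1]; linarith [hδ.2]
      nlinarith [sq_abs (s / δ)]
  simpa using h

lemma norm_fderiv_comp_le {u : E2 → ℝ} (hu : ContDiff ℝ (⊤ : ℕ∞) u) (δ : ℝ) (x : E2) :
    ‖fderiv ℝ (fun y => softThreshold δ (u y)) x‖ ≤ ‖fderiv ℝ u x‖ := by
  have hd : HasFDerivAt u (fderiv ℝ u x) x := (hu.differentiable (by simp) x).hasFDerivAt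
  have hc := (hasDerivAt δ (u x)).comp_hasFDerivAt x hd
  rw [Function.comp_def] at hc
  rw [hc.fderiv, norm_smul,
    Real.norm_of_nonneg (Real.smoothTransition.nonneg _)]
  exact mul_le_of_le_one_left (norm_nonneg _) (Real.smoothTransition.le_one _)

end softThreshold

lemma rayleigh_nonneg (Ω : Set E2) (u : E2 → ℝ) : 0 ≤ rayleigh Ω u :=
  div_nonneg (integral_nonneg fun _ => sq_nonneg _) (integral_nonneg fun _ => sq_nonneg _)

lemma firstMixedEig_le {Ω D : Set E2} {u : E2 → ℝ} (hu : ContDiff ℝ (⊤ : ℕ∞) u)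
    (hD : ∀ x ∈ D, u x = 0) (h0 : NotAEZero Ω u) : firstMixedEig Ω D ≤ rayleigh Ω u :=
  csInf_le ⟨0, by rintro _ ⟨v, -, -, -, rfl⟩; exact rayleigh_nonneg Ω v⟩ ⟨u, hu, hD, h0, rfl⟩

lemma notAEZero_of_integral_pos {Ω : Set E2} {u : E2 → ℝ} (h : 0 < ∫ x in Ω, u x ^ 2) :
    NotAEZero Ω u := by
  intro h0
  refine h.ne' (integral_eq_zero_of_ae ?_)
  filter_upwards [h0] with x hx
  simp [hx]

lemma integral_pos_of_notAEZero {Ω : Set E2} {u : E2 → ℝ} (h0 : NotAEZero Ω u)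
    (hi : IntegrableOn (fun x => u x ^ 2) Ω) : 0 < ∫ x in Ω, u x ^ 2 := by
  refine (integral_nonneg fun _ => sq_nonneg _).lt_of_ne' fun h => h0 ?_
  filter_upwards [(integral_eq_zero_iff_of_nonneg (fun _ => sq_nonneg _) hi).1 h] with x hx
  simpa using hx

lemma continuous_norm_fderiv_sq {u : E2 → ℝ} (hu : ContDiff ℝ (⊤ : ℕ∞) u) :
    Continuous fun x => ‖fderiv ℝ u x‖ ^ 2 :=
  (hu.continuous_fderiv (by simp)).norm.pow 2

namespace IsReflection

variable {b : AffineBasis (Fin 3) ℝ E2} {σ : E2 ≃ᵃⁱ[ℝ] E2} {m : E2}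

lemma tendsto_setIntegral_comp_foldMap (h : IsReflection b σ m) {g : E2 → ℝ} (hg : Continuous g) :
    Tendsto (fun ε => ∫ x in interior (convexHull ℝ (range b) ∪ σ '' convexHull ℝ (range b)),
        g (foldMap (b.coord 0) m ε x)) (𝓝[>] 0)
      (𝓝 (2 * ∫ x in interior (convexHull ℝ (range b)), g x)) := by
  have hKc : IsCompact (convexHull ℝ (range b)) := (finite_range b).isCompact_convexHull ℝ
  rw [← h.setIntegral_comp_foldMap hg]
  simp only [setIntegral_congr_set (interior_union_ae_eq b σ)]
  have := continuous_parametric_integral_of_continuous (μ := (volume : Measure E2))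
    (f := fun ε x => g (foldMap (b.coord 0) m ε x))
    (hg.comp (continuous_foldMap (continuous_barycentric_coord b 0) m))
    (hKc.union (hKc.image σ.continuous))
  exact (this.tendsto 0).mono_left nhdsWithin_le_nhds

lemma norm_fderiv_comp_foldMap_le (h : IsReflection b σ m) {ψ : E2 → ℝ}
    (hψ : ContDiff ℝ (⊤ : ℕ∞) ψ) {ε : ℝ} (hε : ε ≠ 0) (x : E2) :
    ‖fderiv ℝ (fun y => ψ (foldMap (b.coord 0) m ε y)) x‖ ≤
      ‖fderiv ℝ ψ (foldMap (b.coord 0) m ε x)‖ := by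
  have hα : ContDiff ℝ (⊤ : ℕ∞) (b.coord 0) :=
    (smooth_barycentric_coord b 0).of_le (by exact_mod_cast le_top)
  have hd : ∀ y, HasFDerivAt (b.coord 0) (LinearMap.toContinuousLinearMap (b.coord 0).linear) y := by
    intro y
    have e : (b.coord 0 : E2 → ℝ) =
        fun z => LinearMap.toContinuousLinearMap (b.coord 0).linear z + b.coord 0 0 := by
      funext z
      have := (b.coord 0).map_vadd 0 z
      simpa using this
    conv => enter [1]; rw [e]
    exact (ContinuousLinearMap.hasFDerivAt _).add_const _
  have hF := (contDiff_foldMap hα m hε).differentiable (by simp) x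
  have hψd := hψ.differentiable (by simp) (foldMap (b.coord 0) m ε x)
  have hc := hψd.hasFDerivAt.comp x hF.hasFDerivAt
  rw [Function.comp_def] at hc
  rw [hc.fderiv]
  refine (ContinuousLinearMap.opNorm_comp_le _ _).trans
    (mul_le_of_le_one_right (norm_nonneg _) ?_)
  exact norm_fderiv_foldMap_le hd h.norm_sub_smul hε x

/-- A function vanishing near the Dirichlet sides can be reflected and smoothed without losing the
Dirichlet condition. -/
lemma firstMixedEig_le_of_eq_zero_near (h : IsReflection b σ m) {ψ : E2 → ℝ}
    (hψ : ContDiff ℝ (⊤ : ℕ∞) ψ) {η : ℝ} (hη : 0 < η)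
    (h0 : ∀ x ∈ Metric.thickening η (segment ℝ (b 0) (b 2) ∪ segment ℝ (b 0) (b 1)), ψ x = 0)
    (hpos : 0 < ∫ x in interior (convexHull ℝ (range b)), ψ x ^ 2) :
    firstMixedEig (interior (convexHull ℝ (range b) ∪ σ '' convexHull ℝ (range b)))
        (frontier (interior (convexHull ℝ (range b) ∪ σ '' convexHull ℝ (range b)))) ≤
      rayleigh (interior (convexHull ℝ (range b))) ψ := by
  have hα : ContDiff ℝ (⊤ : ℕ∞) (b.coord 0) :=
    (smooth_barycentric_coord b 0).of_le (by exact_mod_cast le_top)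
  have hKc : IsCompact (convexHull ℝ (range b)) := (finite_range b).isCompact_convexHull ℝ
  have hD := h.tendsto_setIntegral_comp_foldMap (hψ.continuous.pow 2)
  have hN := h.tendsto_setIntegral_comp_foldMap (continuous_norm_fderiv_sq hψ)
  have hpos2 : 0 < 2 * ∫ x in interior (convexHull ℝ (range b)), ψ x ^ 2 := by positivity
  have hlim := hN.div hD hpos2.ne'
  rw [mul_div_mul_left _ _ two_ne_zero] at hlim
  refine ge_of_tendsto hlim ?_
  have hsmall : ∀ᶠ ε : ℝ in 𝓝[>] 0, |ε| * ‖m‖ < η := by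
    have : Tendsto (fun ε : ℝ => |ε| * ‖m‖) (𝓝 0) (𝓝 0) := by
      have : Continuous fun ε : ℝ => |ε| * ‖m‖ := by fun_prop
      simpa using this.tendsto 0
    exact (this.eventually_lt_const hη).filter_mono nhdsWithin_le_nhds
  filter_upwards [hsmall, hD.eventually_const_lt hpos2, self_mem_nhdsWithin] with ε hε1 hε2 hε3
  have hε : ε ≠ 0 := ne_of_gt hε3
  refine (firstMixedEig_le (u := fun x => ψ (foldMap (b.coord 0) m ε x))
    (hψ.comp (contDiff_foldMap hα m hε)) (fun x hx => ?_) (notAEZero_of_integral_pos hε2)).trans ?_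
  · refine h0 _ (Metric.mem_thickening_iff.2 ⟨_, h.foldMap_mem_of_mem_frontier hx, ?_⟩)
    exact (dist_foldMap_le _ m ε x).trans_lt hε1
  · refine div_le_div_of_nonneg_right ?_ hε2.le
    have hsub : interior (convexHull ℝ (range b) ∪ σ '' convexHull ℝ (range b)) ⊆
        convexHull ℝ (range b) ∪ σ '' convexHull ℝ (range b) := interior_subset
    have hQ := hKc.union (hKc.image σ.continuous)
    have hF : Continuous (foldMap (b.coord 0) m ε) := (contDiff_foldMap hα m hε).continuous
    refine integral_mono ?_ ?_ fun x => ?_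
    · exact ((continuous_norm_fderiv_sq
        (hψ.comp (contDiff_foldMap hα m hε))).continuousOn.integrableOn_compact hQ).mono_set hsub
    · exact (((continuous_norm_fderiv_sq hψ).comp hF).continuousOn.integrableOn_compact
        hQ).mono_set hsub
    · exact pow_le_pow_left₀ (norm_nonneg _) (h.norm_fderiv_comp_foldMap_le hψ hε x) 2

lemma firstMixedEig_le_rayleigh (h : IsReflection b σ m) {u : E2 → ℝ}
    (hu : ContDiff ℝ (⊤ : ℕ∞) u)
    (h0 : ∀ x ∈ segment ℝ (b 0) (b 2) ∪ segment ℝ (b 0) (b 1), u x = 0)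
    (hne : NotAEZero (interior (convexHull ℝ (range b))) u) :
    firstMixedEig (interior (convexHull ℝ (range b) ∪ σ '' convexHull ℝ (range b)))
        (frontier (interior (convexHull ℝ (range b) ∪ σ '' convexHull ℝ (range b)))) ≤
      rayleigh (interior (convexHull ℝ (range b))) u := by
  have hKc : IsCompact (convexHull ℝ (range b)) := (finite_range b).isCompact_convexHull ℝ
  have hion : ∀ {g : E2 → ℝ}, Continuous g → IntegrableOn g (interior (convexHull ℝ (range b))) :=
    fun hg => (hg.continuousOn.integrableOn_compact hKc).mono_set interior_subset
  have hpos := integral_pos_of_notAEZero hne (hion (hu.continuous.pow 2))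
  have hD : Tendsto (fun δ => ∫ x in interior (convexHull ℝ (range b)),
      softThreshold δ (u x) ^ 2) (𝓝[>] 0)
      (𝓝 (∫ x in interior (convexHull ℝ (range b)), u x ^ 2)) := by
    refine tendsto_integral_filter_of_dominated_convergence (fun x => u x ^ 2)
      (Eventually.of_forall fun δ =>
        (((softThreshold.contDiff δ).continuous.comp hu.continuous).pow 2).aestronglyMeasurable)
      (Eventually.of_forall fun δ => Eventually.of_forall fun x => ?_)
      (hion (hu.continuous.pow 2)) (Eventually.of_forall fun x => ?_)
    · rw [Real.norm_of_nonneg (sq_nonneg _)]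
      exact sq_le_sq.2 (softThreshold.abs_le δ (u x))
    · exact (softThreshold.tendsto (u x)).pow 2
  have hlim := (tendsto_const_nhds (x := ∫ x in interior (convexHull ℝ (range b)),
    ‖fderiv ℝ u x‖ ^ 2)).div hD hpos.ne'
  refine ge_of_tendsto hlim ?_
  filter_upwards [hD.eventually_const_lt hpos, self_mem_nhdsWithin] with δ hδ hδ0
  have hψ : ContDiff ℝ (⊤ : ℕ∞) fun x => softThreshold δ (u x) :=
    (softThreshold.contDiff δ).comp hu
  have hseg : IsCompact (segment ℝ (b 0) (b 2) ∪ segment ℝ (b 0) (b 1)) := by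
    rw [← convexHull_pair, ← convexHull_pair]
    exact ((toFinite _).isCompact_convexHull ℝ).union ((toFinite _).isCompact_convexHull ℝ)
  obtain ⟨η, hη, hsub⟩ := hseg.exists_thickening_subset_open
    (isOpen_lt hu.continuous.abs (continuous_const (y := δ)))
    (fun x hx => by simpa [h0 x hx] using hδ0)
  refine (h.firstMixedEig_le_of_eq_zero_near hψ hη
    (fun x hx => softThreshold.eq_zero (hsub hx).le) hδ).trans
    (div_le_div_of_nonneg_right ?_ hδ.le)
  refine integral_mono (hion (continuous_norm_fderiv_sq hψ)) (hion (continuous_norm_fderiv_sq hu))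
    fun x => ?_
  exact pow_le_pow_left₀ (norm_nonneg _) (softThreshold.norm_fderiv_comp_le hu δ x) 2

end IsReflection

/-- The product of two barycentric coordinates is an admissible function for the mixed problem. -/
lemma exists_smooth_notAEZero (b : AffineBasis (Fin 3) ℝ E2) :
    ∃ u : E2 → ℝ, ContDiff ℝ (⊤ : ℕ∞) u ∧
      (∀ x ∈ segment ℝ (b 0) (b 2) ∪ segment ℝ (b 0) (b 1), u x = 0) ∧
      NotAEZero (interior (convexHull ℝ (range b))) u := by
  have hs : ∀ i, ContDiff ℝ (⊤ : ℕ∞) (b.coord i) := fun i =>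
    (smooth_barycentric_coord b i).of_le (by exact_mod_cast le_top)
  have hz : ∀ {i j k : Fin 3}, i ≠ j → i ≠ k → ∀ x ∈ segment ℝ (b j) (b k), b.coord i x = 0 := by
    intro i j k hij hik x hx
    rw [segment_eq_image_lineMap] at hx
    obtain ⟨t, -, rfl⟩ := hx
    rw [AffineMap.apply_lineMap]
    simp [b.coord_apply_ne hij, b.coord_apply_ne hik]
  refine ⟨fun x => b.coord 1 x * b.coord 2 x, (hs 1).mul (hs 2), ?_, fun h0 => ?_⟩
  · rintro x (hx | hx)
    · simp [hz (i := 1) (by decide) (by decide) x hx]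
    · simp [hz (i := 2) (by decide) (by decide) x hx]
  · have hne : (interior (convexHull ℝ (range b))).Nonempty :=
      interior_convexHull_nonempty_iff_affineSpan_eq_top.2 b.tot
    refine (isOpen_interior.measure_pos volume hne).ne' ?_
    rw [ae_restrict_iff' measurableSet_interior] at h0
    refine measure_mono_null (fun x hx => ?_) h0
    have hx' := b.interior_convexHull ▸ hx
    exact fun hx0 => (mul_pos (hx' 1) (hx' 2)).ne' (hx0 hx)

/-- Let `T = △ABC` be a nondegenerate triangle with longest side `L = BC`
(on which the Neumann condition is imposed; Dirichlet on `M ∪ S = AC ∪ AB`), and let `σ` be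
the reflection of the plane across the line containing `BC` (characterized as the nonidentity
affine isometry fixing `B` and `C`). Let `Q` be the open quadrilateral obtained as the
interior of the union of the closure of `T` and its reflection. Then
`λ₁^{MS}(T) ≥ λ₁(Q)`, where `λ₁(Q)` is the first Dirichlet eigenvalue on `Q`
(Dirichlet condition on all of `∂Q`). -/
theorem stmt_5 (A B C : E2)
    (hT : ¬ Collinear ℝ ({A, B, C} : Set E2))
    (hL1 : dist A C ≤ dist B C) (hL2 : dist A B ≤ dist B C)
    (σ : E2 ≃ᵃⁱ[ℝ] E2) (hσB : σ B = B) (hσC : σ C = C)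
    (hσ : σ ≠ AffineIsometryEquiv.refl ℝ E2) :
    firstMixedEig (triangleO A B C) (segment ℝ A C ∪ segment ℝ A B) ≥
      firstMixedEig
        (interior (convexHull ℝ ({A, B, C} : Set E2) ∪
          ⇑σ '' convexHull ℝ ({A, B, C} : Set E2)))
        (frontier (interior (convexHull ℝ ({A, B, C} : Set E2) ∪
          ⇑σ '' convexHull ℝ ({A, B, C} : Set E2)))) := by
  have hind : AffineIndependent ℝ ![A, B, C] := affineIndependent_iff_not_collinear_set.2 hT
  let b : AffineBasis (Fin 3) ℝ E2 := ⟨![A, B, C], hind, by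
    rw [hind.affineSpan_eq_top_iff_card_eq_finrank_add_one]; simp⟩
  have hrange : ({A, B, C} : Set E2) = range b := by
    change _ = range ![A, B, C]
    ext x
    simp [eq_comm]
    tauto
  have href := IsReflection.of_fixes (b := b) hσB hσC hσ
  rw [triangleO, hrange, ge_iff_le]
  refine le_csInf ?_ ?_
  · obtain ⟨u, hu, h0, hne⟩ := exists_smooth_notAEZero b
    exact ⟨_, u, hu, h0, hne, rfl⟩
  · rintro _ ⟨u, hu, h0, hne, rfl⟩
    exact href.firstMixedEig_le_rayleigh hu h0 hne

end
end
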